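/- arXiv:1605.07534 — 3 statements merged into one kernel-verified Lean document; each statement's English description precedes it below -/
import Mathlib

section
/- Define six linear maps φ₁,…,φ₆ : ℝ² → sl(3,ℝ) by sending (x,y) to, respectively: φ₁(x,y) = [[0,x,y],[0,0,x],[0,0,0]]; φ₂(x,y) = [[0,0,y],[0,0,x],[0,0,0]]; φ₃(x,y) = [[0,x,y],[0,0,0],[0,0,0]]; φ₄(x,y) = [[x,y,0],[0,x,0],[0,0,−2x]]; φ₅(x,y) = [[x,y,0],[−y,x,0],[0,0,−2x]]; φ₆(x,y) = [[x,0,0],[0,y,0],[0,0,−x−y]]. Then for every injective linear map φ : ℝ² → sl(3,ℝ) whose image consists of pairwise commuting matrices, there exist P ∈ GL(3,ℝ) and Q ∈ GL(2,ℝ) such that P·φ(Q v)·P⁻¹ = φᵢ(v) for all v ∈ ℝ² and some i ∈ {1,…,6}; moreover, no two distinct maps φᵢ, φⱼ (i ≠ j) are related to each other by such a pair (P,Q). -/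
open Matrix

/-- The six standard embeddings `ℝ² → sl(3,ℝ)`, as matrix-valued functions of
`v = (x, y)` with `x = v 0`, `y = v 1`. -/
noncomputable def stdPhi : Fin 6 → (Fin 2 → ℝ) → Matrix (Fin 3) (Fin 3) ℝ
  | 0 => fun v => !![0, v 0, v 1; 0, 0, v 0; 0, 0, 0]
  | 1 => fun v => !![0, 0, v 1; 0, 0, v 0; 0, 0, 0]
  | 2 => fun v => !![0, v 0, v 1; 0, 0, 0; 0, 0, 0]
  | 3 => fun v => !![v 0, v 1, 0; 0, v 0, 0; 0, 0, -2 * v 0]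
  | 4 => fun v => !![v 0, v 1, 0; -v 1, v 0, 0; 0, 0, -2 * v 0]
  | 5 => fun v => !![v 0, 0, 0; 0, v 1, 0; 0, 0, -v 0 - v 1]

/-- `φ` is carried to `ψ` by a linear change of coordinates `P ∈ GL(3,ℝ)` in `ℝ³` and
`Q ∈ GL(2,ℝ)` in `ℝ²`:  `P · φ(Q v) · P⁻¹ = ψ(v)` for all `v`. -/
def PhiEquiv (φ ψ : (Fin 2 → ℝ) → Matrix (Fin 3) (Fin 3) ℝ) : Prop :=
  ∃ P : GL (Fin 3) ℝ, ∃ Q : GL (Fin 2) ℝ,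
    ∀ v : Fin 2 → ℝ,
      (P : Matrix (Fin 3) (Fin 3) ℝ) * φ ((Q : Matrix (Fin 2) (Fin 2) ℝ).mulVec v) *
        ((P⁻¹ : GL (Fin 3) ℝ) : Matrix (Fin 3) (Fin 3) ℝ) = ψ v

theorem Matrix.isConj_of_mul_eq_mul {n : Type*} [Fintype n] [DecidableEq n]
    {A B : Matrix n n ℝ} (P : Matrix n n ℝ) (hP : P.det ≠ 0) (h : P * A = B * P) :
    IsConj A B :=
  ⟨GeneralLinearGroup.mkOfDetNeZero P hP, h⟩

theorem exists_root_depressed_cubic (b c : ℝ) : ∃ t : ℝ, t ^ 3 + b * t + c = 0 := by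
  set R := 1 + |b| + |c| with hR
  have hb := abs_nonneg b
  have hc := abs_nonneg c
  have hb1 := le_abs_self b
  have hb2 := neg_abs_le b
  have hc1 := le_abs_self c
  have hc2 := neg_abs_le c
  have hR1 : 1 ≤ R := by linarith
  have hbR : |b| * R ≤ |b| * R ^ 2 := by nlinarith [mul_nonneg hb (by linarith : 0 ≤ R)]
  have hcR : |c| ≤ |c| * R ^ 2 := le_mul_of_one_le_right hc (one_le_pow₀ hR1)
  have hcube : R ^ 3 = R ^ 2 + |b| * R ^ 2 + |c| * R ^ 2 := by rw [hR]; ring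
  have h1 : b * R ≤ |b| * R := by nlinarith
  have h2 : -|b| * R ≤ b * R := by nlinarith
  have hcont : ContinuousOn (fun t : ℝ => t ^ 3 + b * t + c) (Set.Icc (-R) R) := by fun_prop
  have := intermediate_value_Icc (by linarith : -R ≤ R) hcont
  obtain ⟨t, -, ht⟩ := this (show (0 : ℝ) ∈ _ from ⟨by nlinarith, by nlinarith⟩)
  exact ⟨t, ht⟩

theorem exists_conj_fin_two (p q r s : ℝ) :
    ∃ a b c d e f g h : ℝ, a * d - b * c ≠ 0 ∧
      a * p + b * r = e * a + f * c ∧ a * q + b * s = e * b + f * d ∧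
      c * p + d * r = g * a + h * c ∧ c * q + d * s = g * b + h * d ∧
      ((g = 0 ∧ (f = 0 ∨ e = h)) ∨ (e = h ∧ g = -f ∧ f ≠ 0)) := by
  have tri : ∀ p q s : ℝ, ∃ a b c d e f g h : ℝ, a * d - b * c ≠ 0 ∧
      a * p = e * a + f * c ∧ a * q + b * s = e * b + f * d ∧
      c * p = g * a + h * c ∧ c * q + d * s = g * b + h * d ∧
      (g = 0 ∧ (f = 0 ∨ e = h)) := by
    intro p q s
    by_cases hps : p = s
    · exact ⟨1, 0, 0, 1, p, q, 0, s, by norm_num, by ring, by ring, by ring, by ring, rfl, .inr hps⟩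
    · have : p - s ≠ 0 := sub_ne_zero.2 hps
      exact ⟨1, q / (p - s), 0, 1, p, 0, 0, s, by norm_num, by ring, by field_simp; ring, by ring,
        by ring, rfl, .inl rfl⟩
  by_cases hr : r = 0
  · obtain ⟨a, b, c, d, e, f, g, h, h0, h1, h2, h3, h4, h5⟩ := tri p q s
    exact ⟨a, b, c, d, e, f, g, h, h0, by simpa [hr] using h1, h2, by simpa [hr] using h3, h4,
      .inl h5⟩
  rcases le_or_gt 0 ((p - s) ^ 2 + 4 * q * r) with hD | hD
  · set δ := √((p - s) ^ 2 + 4 * q * r)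
    have hδ : δ ^ 2 = (p - s) ^ 2 + 4 * q * r := Real.sq_sqrt hD
    obtain ⟨μ, hμ⟩ : ∃ μ, μ = (p + s + δ) / 2 := ⟨_, rfl⟩
    have hμ2 : μ ^ 2 - (p + s) * μ + (p * s - q * r) = 0 := by
      rw [hμ]; linear_combination hδ / 4
    -- conjugation by `(0, 1; r, s - μ)` gives `(μ, 1; 0, p + s - μ)`
    obtain ⟨a, b, c, d, e, f, g, h, h0, h1, h2, h3, h4, h5⟩ := tri μ 1 (p + s - μ)
    refine ⟨b * r, a - b * (μ - s), d * r, c - d * (μ - s), e, f, g, h, ?_, ?_, ?_, ?_, ?_, .inl h5⟩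
    · have : b * r * (c - d * (μ - s)) - (a - b * (μ - s)) * (d * r) = -(a * d - b * c) * r := by
        ring
      rw [this]
      exact mul_ne_zero (neg_ne_zero.2 h0) hr
    · linear_combination r * h2
    · linear_combination h1 - (μ - s) * h2 - b * hμ2
    · linear_combination r * h4
    · linear_combination h3 - (μ - s) * h4 - d * hμ2
  · set β := √(-((p - s) ^ 2 + 4 * q * r))
    have hβ : β ^ 2 = -((p - s) ^ 2 + 4 * q * r) := Real.sq_sqrt (by linarith)
    have hβ0 : β ≠ 0 := by intro h; rw [h] at hβ; linarith
    refine ⟨2 * r, s - p, 0, β, (p + s) / 2, -β / 2, β / 2, (p + s) / 2, ?_, ?_, ?_, ?_, ?_,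
      .inr ⟨rfl, by ring, by simpa using hβ0⟩⟩
    · simpa using ⟨hr, hβ0⟩
    · ring
    · linear_combination hβ / 2
    · ring
    · ring

theorem exists_conj_fin_three_of_trace_eq_zero (A : Matrix (Fin 3) (Fin 3) ℝ) (hA : A.trace = 0) :
    ∃ l x y a b c d : ℝ, l + a + d = 0 ∧ IsConj A !![l, x, y; 0, a, b; 0, c, d] ∧
      ((c = 0 ∧ (b = 0 ∨ a = d)) ∨ (a = d ∧ c = -b ∧ b ≠ 0)) := by
  obtain ⟨t, ht⟩ := exists_root_depressed_cubic
    (A 0 0 * A 1 1 + A 0 0 * A 2 2 + A 1 1 * A 2 2 - A 0 1 * A 1 0 - A 0 2 * A 2 0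
      - A 1 2 * A 2 1) (-A.det)
  have htr : A 0 0 + A 1 1 + A 2 2 = 0 := by simpa [trace, Fin.sum_univ_three] using hA
  have hdet : (A - t • (1 : Matrix (Fin 3) (Fin 3) ℝ)).det = 0 := by
    rw [det_fin_three] at ht ⊢
    simp
    linear_combination -ht + t ^ 2 * htr
  obtain ⟨u, hu, hAu⟩ := exists_mulVec_eq_zero_iff.2 hdet
  obtain ⟨P, hP, hPu⟩ : ∃ P : Matrix (Fin 3) (Fin 3) ℝ, P.det ≠ 0 ∧ ∀ i, P i 0 = u i := by
    by_cases h0 : u 0 = 0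
    · by_cases h1 : u 1 = 0
      · have h2 : u 2 ≠ 0 := fun h2 => hu (by ext i; fin_cases i <;> assumption)
        exact ⟨!![u 0, 1, 0; u 1, 0, 1; u 2, 0, 0], by simpa [det_fin_three] using h2,
          by intro i; fin_cases i <;> rfl⟩
      · exact ⟨!![u 0, 1, 0; u 1, 0, 0; u 2, 0, 1], by simpa [det_fin_three] using h1,
          by intro i; fin_cases i <;> rfl⟩
    · exact ⟨!![u 0, 0, 0; u 1, 1, 0; u 2, 0, 1], by simpa [det_fin_three] using h0,
          by intro i; fin_cases i <;> rfl⟩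
  set B := P⁻¹ * A * P with hB
  have hPB : P * B = A * P := by
    rw [hB, ← mul_assoc, ← mul_assoc, mul_nonsing_inv _ (isUnit_iff_ne_zero.2 hP), one_mul]
  have hBt : B.trace = 0 := by
    rw [hB, trace_mul_comm, ← mul_assoc, mul_nonsing_inv _ (isUnit_iff_ne_zero.2 hP), one_mul, hA]
  have hcol : ∀ i, B i 0 = if i = 0 then t else 0 := by
    have h1 : P *ᵥ (Pi.single 0 1) = u := by ext i; simp [hPu]
    have h2 : A *ᵥ u = t • u := by
      rw [sub_mulVec, smul_mulVec, one_mulVec, sub_eq_zero] at hAu; exact hAu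
    have h3 : B *ᵥ (Pi.single 0 1) = t • Pi.single 0 1 := by
      rw [hB, ← mulVec_mulVec, ← mulVec_mulVec, h1, h2, ← h1, mulVec_smul, mulVec_mulVec,
        nonsing_inv_mul _ (isUnit_iff_ne_zero.2 hP), one_mulVec]
    intro i
    simpa [Pi.single_apply] using congrFun h3 i
  obtain ⟨a, b, c, d, e, f, g, h, h0, h1, h2, h3, h4, h5⟩ :=
    exists_conj_fin_two (B 1 1) (B 1 2) (B 2 1) (B 2 2)
  have hc0 := hcol 0
  have hc1 := hcol 1
  have hc2 := hcol 2
  simp at hc0 hc1 hc2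
  have hBtr : t + B 1 1 + B 2 2 = 0 := by
    simpa [trace, Fin.sum_univ_three, hc0] using hBt
  have htr2 : (a * d - b * c) * (e + h) = (a * d - b * c) * (B 1 1 + B 2 2) := by
    linear_combination -d * h1 + c * h2 + b * h3 - a * h4
  have htr3 := mul_left_cancel₀ h0 htr2
  obtain ⟨x, y, hx, hy⟩ : ∃ x y, B 0 1 = x * a + y * c ∧ B 0 2 = x * b + y * d := by
    refine ⟨(B 0 1 * d - B 0 2 * c) / (a * d - b * c), (B 0 2 * a - B 0 1 * b) / (a * d - b * c),
      ?_, ?_⟩ <;> rw [div_mul_eq_mul_div, div_mul_eq_mul_div, ← add_div, eq_div_iff h0] <;> ring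
  refine ⟨t, x, y, e, f, g, h, by linarith, ?_, h5⟩
  have c1 : IsConj A B := (isConj_of_mul_eq_mul P hP hPB).symm
  refine c1.trans (isConj_of_mul_eq_mul !![1, 0, 0; 0, a, b; 0, c, d]
    (by simpa [det_fin_three] using h0) ?_)
  ext i j
  fin_cases i <;> fin_cases j <;>
    simp [Matrix.mul_apply, Fin.sum_univ_three, hc0, hc1, hc2, hx, hy, h1, h2, h3, h4]

/-- Normal forms of a traceless real `3 × 3` matrix under conjugation; the matrices of
square zero are left unreduced. -/
theorem exists_normal_form (A : Matrix (Fin 3) (Fin 3) ℝ) (hA : A.trace = 0) :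
    A ^ 2 = 0 ∨
    IsConj A !![0, 1, 0; 0, 0, 1; 0, 0, 0] ∨
    (∃ a b, a ≠ 0 ∧ IsConj A !![a, b, 0; 0, a, 0; 0, 0, -2 * a]) ∨
    (∃ a b, b ≠ 0 ∧ IsConj A !![a, b, 0; -b, a, 0; 0, 0, -2 * a]) ∨
    (∃ a b c, a ≠ b ∧ a ≠ c ∧ b ≠ c ∧ IsConj A !![a, 0, 0; 0, b, 0; 0, 0, c]) := by
  obtain ⟨l, x, y, a, b, c, d, h0, hc, h⟩ := exists_conj_fin_three_of_trace_eq_zero A hA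
  rcases h with ⟨rfl, h⟩ | ⟨rfl, rfl, hb⟩
  · by_cases had : a = d
    · subst had
      by_cases hla : l = a
      · subst hla
        obtain rfl : l = 0 := by linarith
        by_cases hxb : x * b = 0
        · left
          obtain ⟨P, hP⟩ := hc
          have hP2 := hP.pow_right 2
          have : (!![0, x, y; 0, 0, b; 0, 0, 0] : Matrix (Fin 3) (Fin 3) ℝ) ^ 2 = 0 := by
            ext i j
            fin_cases i <;> fin_cases j <;> simp [pow_two, Matrix.mul_apply, Fin.sum_univ_three]
            simpa using hxb
          rw [SemiconjBy, this, zero_mul] at hP2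
          exact (Units.mul_right_eq_zero P).1 hP2
        · right; left
          refine hc.trans (isConj_of_mul_eq_mul !![1, 0, 0; 0, x, y; 0, 0, x * b] ?_ ?_)
          · simpa [det_fin_three] using hxb
          · ext i j
            fin_cases i <;> fin_cases j <;> simp [Matrix.mul_apply, Fin.sum_univ_three]
      · right; right; left
        have hla' : l - a ≠ 0 := sub_ne_zero.2 hla
        have ha : a ≠ 0 := by rintro rfl; exact hla (by linarith)
        obtain ⟨u, hu⟩ : ∃ u, u * (l - a) = x := ⟨x / (l - a), div_mul_cancel₀ _ hla'⟩
        obtain ⟨w, hw⟩ : ∃ w, w * (l - a) = y + u * b :=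
          ⟨(y + u * b) / (l - a), div_mul_cancel₀ _ hla'⟩
        refine ⟨a, b, ha, hc.trans
          (isConj_of_mul_eq_mul !![0, 1, 0; 0, 0, 1; 1, u, w] (by simp [det_fin_three]) ?_)⟩
        obtain rfl : l = -2 * a := by linarith
        ext i j
        fin_cases i <;> fin_cases j <;> simp [Matrix.mul_apply, Fin.sum_univ_three]
        · linear_combination -hu
        · linear_combination -hw
    · obtain rfl : b = 0 := h.resolve_right had
      by_cases hla : l = a
      · subst hla
        right; right; left
        have hl : l ≠ 0 := by rintro rfl; exact had (by linarith)
        obtain ⟨u, hu⟩ : ∃ u, u * (l - d) = y :=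
          ⟨y / (l - d), div_mul_cancel₀ _ (sub_ne_zero.2 had)⟩
        refine ⟨l, x, hl, hc.trans
          (isConj_of_mul_eq_mul !![1, 0, u; 0, 1, 0; 0, 0, 1] (by simp [det_fin_three]) ?_)⟩
        obtain rfl : d = -2 * l := by linarith
        ext i j
        fin_cases i <;> fin_cases j <;> simp [Matrix.mul_apply, Fin.sum_univ_three]
        linear_combination -hu
      by_cases hld : l = d
      · subst hld
        right; right; left
        have hl : l ≠ 0 := by rintro rfl; exact had (by linarith)
        obtain ⟨u, hu⟩ : ∃ u, u * (l - a) = x :=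
          ⟨x / (l - a), div_mul_cancel₀ _ (sub_ne_zero.2 hla)⟩
        refine ⟨l, y, hl, hc.trans
          (isConj_of_mul_eq_mul !![1, u, 0; 0, 0, 1; 0, 1, 0] (by simp [det_fin_three]) ?_)⟩
        obtain rfl : a = -2 * l := by linarith
        ext i j
        fin_cases i <;> fin_cases j <;> simp [Matrix.mul_apply, Fin.sum_univ_three]
        linear_combination -hu
      · right; right; right; right
        obtain ⟨u, hu⟩ : ∃ u, u * (l - a) = x :=
          ⟨x / (l - a), div_mul_cancel₀ _ (sub_ne_zero.2 hla)⟩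
        obtain ⟨w, hw⟩ : ∃ w, w * (l - d) = y :=
          ⟨y / (l - d), div_mul_cancel₀ _ (sub_ne_zero.2 hld)⟩
        refine ⟨l, a, d, hla, hld, had, hc.trans
          (isConj_of_mul_eq_mul !![1, u, w; 0, 1, 0; 0, 0, 1] (by simp [det_fin_three]) ?_)⟩
        ext i j
        fin_cases i <;> fin_cases j <;> simp [Matrix.mul_apply, Fin.sum_univ_three]
        · linear_combination -hu
        · linear_combination -hw
  · right; right; right; left
    have hD : (l - a) ^ 2 + b ^ 2 ≠ 0 := by positivity
    obtain ⟨u, w, hu, hw⟩ : ∃ u w, u * (l - a) + w * b = x ∧ w * (l - a) - u * b = y := by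
      refine ⟨(x * (l - a) - y * b) / ((l - a) ^ 2 + b ^ 2),
        (x * b + y * (l - a)) / ((l - a) ^ 2 + b ^ 2), ?_, ?_⟩ <;> field_simp <;> ring
    refine ⟨a, b, hb, hc.trans
      (isConj_of_mul_eq_mul !![0, 1, 0; 0, 0, 1; 1, u, w] (by simp [det_fin_three]) ?_)⟩
    obtain rfl : l = -2 * a := by linarith
    ext i j
    fin_cases i <;> fin_cases j <;> simp [Matrix.mul_apply, Fin.sum_univ_three]
    · linear_combination -hu
    · linear_combination -hw

theorem isConj_single_of_sq_eq_zero {A : Matrix (Fin 3) (Fin 3) ℝ} (hA : A.trace = 0)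
    (hA2 : A ^ 2 = 0) (hA0 : A ≠ 0) : IsConj A !![0, 0, 1; 0, 0, 0; 0, 0, 0] := by
  obtain ⟨l, x, y, a, b, c, d, h0, hc, h⟩ := exists_conj_fin_three_of_trace_eq_zero A hA
  obtain ⟨P, hP⟩ := hc
  have hP2 := hP.pow_right 2
  rw [SemiconjBy, hA2, mul_zero, eq_comm, Units.mul_left_eq_zero] at hP2
  have e : ∀ i j, ((!![l, x, y; 0, a, b; 0, c, d] : Matrix (Fin 3) (Fin 3) ℝ) ^ 2) i j = 0 :=
    fun i j => by rw [hP2]; rfl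
  simp only [pow_two, Matrix.mul_apply, Fin.sum_univ_three] at e
  have e00 := e 0 0
  have e02 := e 0 2
  have e11 := e 1 1
  simp at e00 e02 e11
  subst e00
  rcases h with ⟨rfl, -⟩ | ⟨rfl, rfl, hb⟩
  · obtain rfl : a = 0 := by simpa using e11
    obtain rfl : d = 0 := by simpa using h0
    have hxb : x * b = 0 := by simpa using e02
    have hc : IsConj A !![0, x, y; 0, 0, b; 0, 0, 0] := ⟨P, hP⟩
    have hne : ¬(x = 0 ∧ y = 0 ∧ b = 0) := by
      rintro ⟨rfl, rfl, rfl⟩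
      have : (!![0, 0, 0; 0, 0, 0; 0, 0, 0] : Matrix (Fin 3) (Fin 3) ℝ) = 0 := by
        ext i j; fin_cases i <;> fin_cases j <;> rfl
      rw [this, SemiconjBy, zero_mul] at hP
      exact hA0 ((Units.mul_right_eq_zero P).1 hP)
    by_cases hx : x = 0
    · subst hx
      by_cases hb : b = 0
      · subst hb
        have hy : y ≠ 0 := by simpa using hne
        refine hc.trans (isConj_of_mul_eq_mul !![1, 0, 0; 0, 1, 0; 0, 0, y] ?_ ?_)
        · simpa [det_fin_three] using hy
        · ext i j
          fin_cases i <;> fin_cases j <;> simp [Matrix.mul_apply, Fin.sum_univ_three]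
      · refine hc.trans (isConj_of_mul_eq_mul !![0, 1, 0; b, -y, 0; 0, 0, b] ?_ ?_)
        · simpa [det_fin_three] using hb
        · ext i j
          fin_cases i <;> fin_cases j <;> simp [Matrix.mul_apply, Fin.sum_univ_three]
          ring
    · obtain rfl : b = 0 := by simpa [hx] using hxb
      refine hc.trans (isConj_of_mul_eq_mul !![1, 0, 0; 0, 0, 1; 0, x, y] ?_ ?_)
      · simpa [det_fin_three] using hx
      · ext i j
        fin_cases i <;> fin_cases j <;> simp [Matrix.mul_apply, Fin.sum_univ_three]
  · exfalso
    obtain rfl : a = 0 := by linarith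
    simp [hb] at e11

/-- Two matrices that span a plane of commuting traceless matrices. -/
structure IsAbelianPair (A B : Matrix (Fin 3) (Fin 3) ℝ) : Prop where
  comm : A * B = B * A
  trace_left : A.trace = 0
  trace_right : B.trace = 0
  indep : ∀ x y : ℝ, x • A + y • B = 0 → x = 0 ∧ y = 0

/-- Some `P ∈ GL(3,ℝ)` conjugates both matrices into the image of one standard embedding. -/
def HasStdForm (A B : Matrix (Fin 3) (Fin 3) ℝ) : Prop :=
  ∃ (i : Fin 6) (u v : Fin 2 → ℝ) (P : GL (Fin 3) ℝ),
    SemiconjBy (P : Matrix (Fin 3) (Fin 3) ℝ) A (stdPhi i u) ∧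
      SemiconjBy (P : Matrix (Fin 3) (Fin 3) ℝ) B (stdPhi i v)

theorem IsAbelianPair.symm {A B : Matrix (Fin 3) (Fin 3) ℝ} (h : IsAbelianPair A B) :
    IsAbelianPair B A :=
  ⟨h.comm.symm, h.trace_right, h.trace_left, fun x y hxy =>
    (h.indep y x (by rw [add_comm]; exact hxy)).symm⟩

theorem HasStdForm.symm {A B : Matrix (Fin 3) (Fin 3) ℝ} (h : HasStdForm A B) :
    HasStdForm B A :=
  let ⟨i, u, v, P, h1, h2⟩ := h
  ⟨i, v, u, P, h2, h1⟩

theorem HasStdForm.of_eq {A B : Matrix (Fin 3) (Fin 3) ℝ} (i : Fin 6) (u v : Fin 2 → ℝ)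
    (hA : A = stdPhi i u) (hB : B = stdPhi i v) : HasStdForm A B :=
  ⟨i, u, v, 1, by simp [hA], by simp [hB]⟩

theorem HasStdForm.of_conj {A B A' B' : Matrix (Fin 3) (Fin 3) ℝ} (h : HasStdForm A' B')
    (P : GL (Fin 3) ℝ) (hA : SemiconjBy (P : Matrix (Fin 3) (Fin 3) ℝ) A A')
    (hB : SemiconjBy (P : Matrix (Fin 3) (Fin 3) ℝ) B B') : HasStdForm A B :=
  let ⟨i, u, v, R, h1, h2⟩ := h
  ⟨i, u, v, R * P, h1.mul_left hA, h2.mul_left hB⟩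

theorem HasStdForm.of_mul_eq_mul {A B A' B' : Matrix (Fin 3) (Fin 3) ℝ} (h : HasStdForm A' B')
    (P : Matrix (Fin 3) (Fin 3) ℝ) (hP : P.det ≠ 0) (hA : P * A = A' * P) (hB : P * B = B' * P) :
    HasStdForm A B :=
  h.of_conj (GeneralLinearGroup.mkOfDetNeZero P hP) hA hB

theorem Matrix.trace_conj_units {n : Type*} [Fintype n] [DecidableEq n] (P : GL n ℝ)
    (A : Matrix n n ℝ) : ((P : Matrix n n ℝ) * A * (P⁻¹ : GL n ℝ).val).trace = A.trace := by
  rw [trace_mul_comm, ← mul_assoc, Units.inv_mul, one_mul]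

theorem semiconjBy_conj_units {n : Type*} [Fintype n] [DecidableEq n] (P : GL n ℝ)
    (A : Matrix n n ℝ) :
    SemiconjBy (P : Matrix n n ℝ) A ((P : Matrix n n ℝ) * A * (P⁻¹ : GL n ℝ).val) := by
  rw [SemiconjBy, mul_assoc, Units.inv_mul, mul_one]

theorem IsAbelianPair.conj {A B : Matrix (Fin 3) (Fin 3) ℝ} (h : IsAbelianPair A B)
    (P : GL (Fin 3) ℝ) :
    IsAbelianPair ((P : Matrix (Fin 3) (Fin 3) ℝ) * A * (P⁻¹ : GL (Fin 3) ℝ).val)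
      ((P : Matrix (Fin 3) (Fin 3) ℝ) * B * (P⁻¹ : GL (Fin 3) ℝ).val) := by
  refine ⟨?_, ?_, ?_, fun x y hxy => h.indep x y ?_⟩
  · have := h.comm
    simp only [mul_assoc, Units.inv_mul_cancel_left]
    rw [← mul_assoc A, this, mul_assoc]
  · rw [trace_conj_units, h.trace_left]
  · rw [trace_conj_units, h.trace_right]
  · have : (P : Matrix (Fin 3) (Fin 3) ℝ) * (x • A + y • B) * (P⁻¹ : GL (Fin 3) ℝ).val = 0 := by
      rw [← hxy]; simp [mul_add, add_mul]
    rwa [Units.mul_left_eq_zero, Units.mul_right_eq_zero] at this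

theorem IsAbelianPair.hasStdForm_of_isConj {A B A' : Matrix (Fin 3) (Fin 3) ℝ}
    (h : IsAbelianPair A B) (hA : IsConj A A')
    (H : ∀ B', IsConj B B' → IsAbelianPair A' B' → HasStdForm A' B') : HasStdForm A B := by
  obtain ⟨P, hP⟩ := hA
  have hA' : (P : Matrix (Fin 3) (Fin 3) ℝ) * A * (P⁻¹ : GL (Fin 3) ℝ).val = A' := by
    rw [hP.eq, mul_assoc, Units.mul_inv, mul_one]
  have hc := h.conj P
  rw [hA'] at hc
  exact (H _ ⟨P, semiconjBy_conj_units P B⟩ hc).of_conj P hP (semiconjBy_conj_units P B)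

theorem hasStdForm_of_regular_nilpotent {B : Matrix (Fin 3) (Fin 3) ℝ}
    (h : IsAbelianPair !![0, 1, 0; 0, 0, 1; 0, 0, 0] B) :
    HasStdForm !![0, 1, 0; 0, 0, 1; 0, 0, 0] B := by
  have e := fun i j => congrFun (congrFun h.comm i) j
  have ht := h.trace_right
  simp [Fin.forall_fin_succ, Matrix.mul_apply, Fin.sum_univ_three, trace] at e ht
  obtain ⟨⟨e1, e2, e3⟩, ⟨e4, e5, e6⟩, e7, e8⟩ := e
  refine .of_eq 0 ![1, 0] ![B 0 1, B 0 2] ?_ ?_ <;> ext i j <;>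
    fin_cases i <;> fin_cases j <;> simp [stdPhi] <;> linarith

theorem hasStdForm_of_complex_eigenvalue {a b : ℝ} (hb : b ≠ 0) {B : Matrix (Fin 3) (Fin 3) ℝ}
    (h : IsAbelianPair !![a, b, 0; -b, a, 0; 0, 0, -2 * a] B) :
    HasStdForm !![a, b, 0; -b, a, 0; 0, 0, -2 * a] B := by
  have e := fun i j => congrFun (congrFun h.comm i) j
  have ht := h.trace_right
  simp [Fin.forall_fin_succ, Matrix.mul_apply, Fin.sum_univ_three, trace] at e ht
  obtain ⟨⟨e1, e2, e3⟩, ⟨e4, e5, e6⟩, e7, e8, -⟩ := e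
  have hD : 9 * a ^ 2 + b ^ 2 ≠ 0 := by positivity
  have h10 : B 1 0 = -B 0 1 := mul_left_cancel₀ hb (by linarith)
  have h11 : B 1 1 = B 0 0 := mul_left_cancel₀ hb (by linarith)
  have h02 : B 0 2 = 0 := mul_left_cancel₀ hD (by linear_combination 3 * a * e3 - b * e6)
  have h12 : B 1 2 = 0 := mul_left_cancel₀ hD (by linear_combination 3 * a * e6 + b * e3)
  have h20 : B 2 0 = 0 := mul_left_cancel₀ hD (by linear_combination -3 * a * e7 - b * e8)
  have h21 : B 2 1 = 0 := mul_left_cancel₀ hD (by linear_combination -3 * a * e8 + b * e7)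
  refine .of_eq 4 ![a, b] ![B 0 0, B 0 1] ?_ ?_ <;> ext i j <;>
    fin_cases i <;> fin_cases j <;> simp [stdPhi] <;> linarith

theorem hasStdForm_of_distinct_eigenvalues {a b c : ℝ} (hab : a ≠ b) (hac : a ≠ c) (hbc : b ≠ c)
    {B : Matrix (Fin 3) (Fin 3) ℝ} (h : IsAbelianPair !![a, 0, 0; 0, b, 0; 0, 0, c] B) :
    HasStdForm !![a, 0, 0; 0, b, 0; 0, 0, c] B := by
  have e := fun i j => congrFun (congrFun h.comm i) j
  have ht := h.trace_right
  have ht' := h.trace_left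
  simp [Fin.forall_fin_succ, Matrix.mul_apply, Fin.sum_univ_three, trace] at e ht ht'
  obtain ⟨⟨-, e2, e3⟩, ⟨e4, -, e6⟩, e7, e8, -⟩ := e
  have h01 : B 0 1 = 0 := mul_left_cancel₀ (sub_ne_zero.2 hab) (by linear_combination e2)
  have h02 : B 0 2 = 0 := mul_left_cancel₀ (sub_ne_zero.2 hac) (by linear_combination e3)
  have h12 : B 1 2 = 0 := mul_left_cancel₀ (sub_ne_zero.2 hbc) (by linear_combination e6)
  have h10 : B 1 0 = 0 := mul_left_cancel₀ (sub_ne_zero.2 hab) (by linear_combination -e4)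
  have h20 : B 2 0 = 0 := mul_left_cancel₀ (sub_ne_zero.2 hac) (by linear_combination -e7)
  have h21 : B 2 1 = 0 := mul_left_cancel₀ (sub_ne_zero.2 hbc) (by linear_combination -e8)
  refine .of_eq 5 ![a, b] ![B 0 0, B 1 1] ?_ ?_ <;> ext i j <;>
    fin_cases i <;> fin_cases j <;> simp [stdPhi] <;> linarith

theorem hasStdForm_of_double_eigenvalue {a b : ℝ} (ha : a ≠ 0) {B : Matrix (Fin 3) (Fin 3) ℝ}
    (h : IsAbelianPair !![a, b, 0; 0, a, 0; 0, 0, -2 * a] B) :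
    HasStdForm !![a, b, 0; 0, a, 0; 0, 0, -2 * a] B := by
  have e := fun i j => congrFun (congrFun h.comm i) j
  have ht := h.trace_right
  simp only [Fin.forall_fin_succ, Matrix.mul_apply, Fin.sum_univ_three, trace] at e ht
  simp at e ht
  obtain ⟨⟨e1, e2, e3⟩, ⟨e4, e5, e6⟩, e7, e8⟩ := e
  have h12 : B 1 2 = 0 := mul_left_cancel₀ (mul_ne_zero three_ne_zero ha) (by linarith)
  have h20 : B 2 0 = 0 := mul_left_cancel₀ (mul_ne_zero three_ne_zero ha) (by linarith)
  rw [h12] at e3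
  rw [h20] at e8
  have h02 : B 0 2 = 0 := mul_left_cancel₀ (mul_ne_zero three_ne_zero ha) (by linarith)
  have h21 : B 2 1 = 0 := mul_left_cancel₀ (mul_ne_zero three_ne_zero ha) (by linarith)
  by_cases hb : b = 0
  · subst hb
    obtain ⟨p, q, r, s, e, f, g, k, hdet, k1, k2, k3, k4, k5⟩ :=
      exists_conj_fin_two (B 0 0) (B 0 1) (B 1 0) (B 1 1)
    have htr2 : (p * s - q * r) * (e + k) = (p * s - q * r) * (B 0 0 + B 1 1) := by
      linear_combination -s * k1 + r * k2 + q * k3 - p * k4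
    have htr3 := mul_left_cancel₀ hdet htr2
    have h22 : B 2 2 = -(e + k) := by linarith
    refine HasStdForm.of_mul_eq_mul (A' := !![a, 0, 0; 0, a, 0; 0, 0, -2 * a])
      (B' := !![e, f, 0; g, k, 0; 0, 0, -(e + k)]) ?_ !![p, q, 0; r, s, 0; 0, 0, 1]
      (by simpa [det_fin_three] using hdet) ?_ ?_
    · rcases k5 with ⟨rfl, rfl | rfl⟩ | ⟨rfl, rfl, hf⟩
      · refine .of_eq 5 ![a, a] ![e, k] ?_ ?_ <;> ext i j <;>
          fin_cases i <;> fin_cases j <;> simp [stdPhi] <;> ring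
      · refine .of_eq 3 ![a, 0] ![e, f] ?_ ?_ <;> ext i j <;>
          fin_cases i <;> fin_cases j <;> simp [stdPhi]
        ring
      · refine .of_eq 4 ![a, 0] ![e, f] ?_ ?_ <;> ext i j <;>
          fin_cases i <;> fin_cases j <;> simp [stdPhi]
        ring
    · ext i j
      fin_cases i <;> fin_cases j <;> simp [Matrix.mul_apply, Fin.sum_univ_three, mul_comm]
    · ext i j
      fin_cases i <;> fin_cases j <;>
        simp [Matrix.mul_apply, Fin.sum_univ_three, h12, h20, h02, h21, k1, k2, k3, k4, h22]
  · have h10 : B 1 0 = 0 := mul_left_cancel₀ hb (by linarith)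
    have h11 : B 1 1 = B 0 0 := mul_left_cancel₀ hb (by linarith)
    refine .of_eq 3 ![a, b] ![B 0 0, B 0 1] ?_ ?_ <;> ext i j <;>
      fin_cases i <;> fin_cases j <;> simp [stdPhi] <;> linarith

theorem hasStdForm_of_sq_eq_zero {B : Matrix (Fin 3) (Fin 3) ℝ} (hB : B ^ 2 = 0)
    (h : IsAbelianPair !![0, 0, 1; 0, 0, 0; 0, 0, 0] B) :
    HasStdForm !![0, 0, 1; 0, 0, 0; 0, 0, 0] B := by
  have e := fun i j => congrFun (congrFun h.comm i) j
  have ht := h.trace_right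
  have hsq := fun i j => congrFun (congrFun hB i) j
  simp [Fin.forall_fin_succ, Matrix.mul_apply, Fin.sum_univ_three, trace, pow_two] at e ht hsq
  obtain ⟨⟨e1, e2, e3⟩, e4, e5⟩ := e
  have h00 : B 0 0 = 0 := by simpa [← e4, e1] using hsq.1.1
  have h22 : B 2 2 = 0 := e3.trans h00
  have h11 : B 1 1 = 0 := by linarith
  have hxb : B 0 1 * B 1 2 = 0 := by simpa [h00, h22] using hsq.1.2.2
  rcases mul_eq_zero.1 hxb with h01 | h12
  · refine .of_eq 1 ![0, 1] ![B 1 2, B 0 2] ?_ ?_ <;> ext i j <;>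
      fin_cases i <;> fin_cases j <;> simp [stdPhi] <;> linarith
  · refine .of_eq 2 ![0, 1] ![B 0 1, B 0 2] ?_ ?_ <;> ext i j <;>
      fin_cases i <;> fin_cases j <;> simp [stdPhi] <;> linarith

theorem IsAbelianPair.sq_eq_zero_or_hasStdForm {A B : Matrix (Fin 3) (Fin 3) ℝ}
    (h : IsAbelianPair A B) : A ^ 2 = 0 ∨ HasStdForm A B := by
  rcases exists_normal_form A h.trace_left with hA | hA | ⟨a, b, ha, hA⟩ | ⟨a, b, hb, hA⟩ |
    ⟨a, b, c, hab, hac, hbc, hA⟩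
  · exact .inl hA
  · exact .inr (h.hasStdForm_of_isConj hA fun _ _ => hasStdForm_of_regular_nilpotent)
  · exact .inr (h.hasStdForm_of_isConj hA fun _ _ => hasStdForm_of_double_eigenvalue ha)
  · exact .inr (h.hasStdForm_of_isConj hA fun _ _ => hasStdForm_of_complex_eigenvalue hb)
  · exact .inr (h.hasStdForm_of_isConj hA fun _ _ => hasStdForm_of_distinct_eigenvalues hab hac hbc)

theorem IsAbelianPair.hasStdForm {A B : Matrix (Fin 3) (Fin 3) ℝ} (h : IsAbelianPair A B) :
    HasStdForm A B := by
  rcases h.sq_eq_zero_or_hasStdForm with hA | hAB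
  · rcases h.symm.sq_eq_zero_or_hasStdForm with hB | hBA
    · have hA0 : A ≠ 0 := by
        rintro rfl
        exact one_ne_zero (h.indep 1 0 (by simp)).1
      refine h.hasStdForm_of_isConj (isConj_single_of_sq_eq_zero h.trace_left hA hA0) ?_
      rintro B' ⟨P, hP⟩ hB'
      refine hasStdForm_of_sq_eq_zero ?_ hB'
      have hP2 := hP.pow_right 2
      rwa [SemiconjBy, hB, mul_zero, eq_comm, Units.mul_left_eq_zero] at hP2
    · exact hBA.symm
  · exact hAB

theorem exists_phiEquiv_stdPhi (φ : (Fin 2 → ℝ) →ₗ[ℝ] Matrix (Fin 3) (Fin 3) ℝ)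
    (hinj : Function.Injective φ) (htr : ∀ v, (φ v).trace = 0)
    (hcomm : ∀ v w, φ v * φ w = φ w * φ v) : ∃ i, PhiEquiv (fun v => φ v) (stdPhi i) := by
  have hspan : ∀ v : Fin 2 → ℝ, v = v 0 • ![1, 0] + v 1 • ![0, 1] := by
    intro v; ext i; fin_cases i <;> simp
  have hφ : ∀ v, φ v = v 0 • φ ![1, 0] + v 1 • φ ![0, 1] := by
    intro v
    conv_lhs => rw [hspan v]
    rw [map_add, map_smul, map_smul]
  have hpair : IsAbelianPair (φ ![1, 0]) (φ ![0, 1]) := by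
    refine ⟨hcomm _ _, htr _, htr _, fun x y hxy => ?_⟩
    have := hinj (a₁ := ![x, y]) (a₂ := 0) (by rw [hφ]; simpa using hxy)
    exact ⟨by simpa using congrFun this 0, by simpa using congrFun this 1⟩
  obtain ⟨i, u, w, P, hu, hw⟩ := hpair.hasStdForm
  let T : (Fin 2 → ℝ) →ₗ[ℝ] (Fin 2 → ℝ) := Matrix.toLin' !![u 0, w 0; u 1, w 1]
  have hT : ∀ v, T v = v 0 • u + v 1 • w := by
    intro v
    ext k
    fin_cases k <;> simp [T, Matrix.mulVec, dotProduct, Fin.sum_univ_two] <;> ring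
  have hlin : ∀ (a b : ℝ), stdPhi i (a • u + b • w) = a • stdPhi i u + b • stdPhi i w := by
    intro a b
    fin_cases i <;> ext k l <;> fin_cases k <;> fin_cases l <;> simp [stdPhi] <;> ring
  have hzero : stdPhi i 0 = 0 := by
    have := hlin 0 0
    simpa using this
  have hPT : ∀ v, (P : Matrix (Fin 3) (Fin 3) ℝ) * φ v = stdPhi i (T v) * P := by
    intro v
    rw [hφ, hT, hlin, mul_add, add_mul, mul_smul_comm, mul_smul_comm, smul_mul_assoc,
      smul_mul_assoc, hu.eq, hw.eq]
  have hTinj : Function.Injective T := by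
    rw [← LinearMap.ker_eq_bot, LinearMap.ker_eq_bot']
    intro v hv
    have := hPT v
    rw [hv, hzero, zero_mul, Units.mul_right_eq_zero] at this
    exact hinj (by rw [this, map_zero])
  let e := LinearEquiv.ofInjectiveEndo T hTinj
  let Q : GL (Fin 2) ℝ := GeneralLinearGroup.toLin.symm
    (LinearMap.GeneralLinearGroup.ofLinearEquiv e.symm)
  have hQ : ∀ v, T ((Q : Matrix (Fin 2) (Fin 2) ℝ) *ᵥ v) = v := by
    intro v
    have : (Q : Matrix (Fin 2) (Fin 2) ℝ) *ᵥ v = e.symm v :=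
      LinearMap.toMatrix'_mulVec (e.symm : (Fin 2 → ℝ) →ₗ[ℝ] Fin 2 → ℝ) v
    rw [this]
    exact e.apply_symm_apply v
  refine ⟨i, P, Q, fun v => ?_⟩
  rw [hPT, hQ, mul_assoc, Units.mul_inv, mul_one]

theorem PhiEquiv.symm {φ ψ : (Fin 2 → ℝ) → Matrix (Fin 3) (Fin 3) ℝ} (h : PhiEquiv φ ψ) :
    PhiEquiv ψ φ := by
  obtain ⟨P, Q, h⟩ := h
  refine ⟨P⁻¹, Q⁻¹, fun v => ?_⟩
  rw [← h, mulVec_mulVec, Units.mul_inv, one_mulVec, inv_inv, mul_assoc, mul_assoc,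
    Units.inv_mul, mul_one, Units.inv_mul_cancel_left]

theorem PhiEquiv.exists_of_exists {φ ψ : (Fin 2 → ℝ) → Matrix (Fin 3) (Fin 3) ℝ}
    (h : PhiEquiv φ ψ) (p : Matrix (Fin 3) (Fin 3) ℝ → Prop) (hp : ∀ A B, IsConj A B → p A → p B)
    (hφ : ∃ v ≠ 0, p (φ v)) : ∃ v ≠ 0, p (ψ v) := by
  obtain ⟨P, Q, h⟩ := h
  obtain ⟨v, hv, hpv⟩ := hφ
  have hQ : (Q : Matrix (Fin 2) (Fin 2) ℝ) *ᵥ ((Q⁻¹ : GL (Fin 2) ℝ).val *ᵥ v) = v := by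
    rw [mulVec_mulVec, Units.mul_inv, one_mulVec]
  refine ⟨(Q⁻¹ : GL (Fin 2) ℝ).val *ᵥ v, ?_, hp (φ v) _ ⟨P, ?_⟩ hpv⟩
  · intro h0
    rw [h0, mulVec_zero] at hQ
    exact hv hQ.symm
  · rw [← h, hQ]
    exact semiconjBy_conj_units P (φ v)

theorem PhiEquiv.exists_cubic_iff {φ ψ : (Fin 2 → ℝ) → Matrix (Fin 3) (Fin 3) ℝ}
    (h : PhiEquiv φ ψ) (b c : ℝ) :
    (∃ v ≠ 0, φ v * φ v * φ v + b • φ v + c • 1 = 0) ↔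
      ∃ v ≠ 0, ψ v * ψ v * ψ v + b • ψ v + c • 1 = 0 := by
  have hp : ∀ A B : Matrix (Fin 3) (Fin 3) ℝ, IsConj A B →
      A * A * A + b • A + c • 1 = 0 → B * B * B + b • B + c • 1 = 0 := by
    rintro A B ⟨P, hP⟩ hA
    have hb : SemiconjBy (P : Matrix (Fin 3) (Fin 3) ℝ) (b • A) (b • B) := by
      rw [SemiconjBy, mul_smul_comm, smul_mul_assoc, hP.eq]
    have hc : SemiconjBy (P : Matrix (Fin 3) (Fin 3) ℝ) (c • 1) (c • 1) := by
      rw [SemiconjBy, mul_smul_comm, smul_mul_assoc, one_mul, mul_one]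
    have := (((hP.mul_right hP).mul_right hP).add_right hb).add_right hc
    rwa [hA, SemiconjBy, mul_zero, eq_comm, Units.mul_left_eq_zero] at this
  exact ⟨h.exists_of_exists _ hp, h.symm.exists_of_exists _ hp⟩

theorem PhiEquiv.exists_sq_ne_zero_iff {φ ψ : (Fin 2 → ℝ) → Matrix (Fin 3) (Fin 3) ℝ}
    (h : PhiEquiv φ ψ) : (∃ v ≠ 0, φ v * φ v ≠ 0) ↔ ∃ v ≠ 0, ψ v * ψ v ≠ 0 := by
  have hp : ∀ A B : Matrix (Fin 3) (Fin 3) ℝ, IsConj A B → A * A ≠ 0 → B * B ≠ 0 := by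
    rintro A B ⟨P, hP⟩ hA hB
    have := hP.mul_right hP
    rw [hB, SemiconjBy, zero_mul, Units.mul_right_eq_zero] at this
    exact hA this
  exact ⟨h.exists_of_exists _ hp, h.symm.exists_of_exists _ hp⟩

theorem vec_two_eq_zero {v : Fin 2 → ℝ} (h0 : v 0 = 0) (h1 : v 1 = 0) : v = 0 := by
  ext i; fin_cases i <;> assumption

theorem exists_stdPhi_eigenvalue_one_iff (i : Fin 6) :
    (∃ v ≠ 0, stdPhi i v * stdPhi i v * stdPhi i v + (-3 : ℝ) • stdPhi i v + (2 : ℝ) • 1 = 0) ↔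
      3 ≤ i := by
  constructor
  · rintro ⟨v, -, h⟩
    have e := congrFun (congrFun h 0) 0
    fin_cases i <;> simp [stdPhi] at e ⊢
  · intro hi
    refine ⟨if i = 5 then ![1, 1] else ![1, 0], by split_ifs <;> simp, ?_⟩
    ext k l
    fin_cases i <;> simp at hi <;> fin_cases k <;> fin_cases l <;>
      simp [stdPhi] <;> norm_num

theorem exists_stdPhi_complex_eigenvalue_iff (i : Fin 6) :
    (∃ v ≠ 0, stdPhi i v * stdPhi i v * stdPhi i v + (1 : ℝ) • stdPhi i v + (0 : ℝ) • 1 = 0) ↔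
      i = 4 := by
  have root : ∀ x : ℝ, x * x * x + x = 0 → x = 0 := fun x hx =>
    (mul_eq_zero.1 (show x * (x ^ 2 + 1) = 0 by linear_combination hx)).resolve_right
      (by positivity)
  constructor
  · rintro ⟨v, hv, h⟩
    have e := fun k l => congrFun (congrFun h k) l
    fin_cases i <;>
      simp [Fin.forall_fin_succ, stdPhi] at e ⊢
    · exact hv (vec_two_eq_zero e.1.1 e.1.2)
    · exact hv (vec_two_eq_zero e.2 e.1)
    · exact hv (vec_two_eq_zero e.1 e.2)
    · obtain ⟨⟨e1, e2⟩, -⟩ := e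
      have h0 : v 0 = 0 := root _ e1
      exact hv (vec_two_eq_zero h0 (by simpa [h0] using e2))
    · exact hv (vec_two_eq_zero (root _ e.1) (root _ e.2.1))
  · rintro rfl
    refine ⟨![0, 1], by simp, ?_⟩
    ext k l
    fin_cases k <;> fin_cases l <;>
      simp [stdPhi]

theorem exists_stdPhi_distinct_eigenvalues_iff (i : Fin 6) :
    (∃ v ≠ 0, stdPhi i v * stdPhi i v * stdPhi i v + (-1 : ℝ) • stdPhi i v + (0 : ℝ) • 1 = 0) ↔
      i = 5 := by
  constructor
  · rintro ⟨v, hv, h⟩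
    have e := fun k l => congrFun (congrFun h k) l
    fin_cases i <;>
      simp [Fin.forall_fin_succ, stdPhi] at e ⊢
    · exact hv (vec_two_eq_zero e.1.1 e.1.2)
    · exact hv (vec_two_eq_zero e.2 e.1)
    · exact hv (vec_two_eq_zero e.1 e.2)
    · obtain ⟨⟨e1, e2⟩, -, e3⟩ := e
      have h0 : v 0 = 0 := by linarith
      exact hv (vec_two_eq_zero h0 (by simpa [h0] using e2))
    · obtain ⟨⟨e1, e2⟩, -, e3⟩ := e
      have h0 : v 0 = 0 := by
        by_contra h0
        have e1' : v 0 ^ 2 - 3 * v 1 ^ 2 - 1 = 0 := mul_left_cancel₀ h0 (by linear_combination e1)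
        have e3' : 4 * v 0 ^ 2 - 1 = 0 := mul_left_cancel₀ h0 (by linear_combination -e3 / 2)
        nlinarith [sq_nonneg (v 1)]
      have h1 : v 1 * (v 1 ^ 2 + 1) = 0 := by rw [h0] at e2; linear_combination -e2
      exact hv (vec_two_eq_zero h0 ((mul_eq_zero.1 h1).resolve_right (by positivity)))
  · rintro rfl
    refine ⟨![1, -1], by simp, ?_⟩
    ext k l
    fin_cases k <;> fin_cases l <;>
      simp [stdPhi]

theorem exists_stdPhi_zero_sq_ne_zero : ∃ v ≠ 0, stdPhi 0 v * stdPhi 0 v ≠ 0 := by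
  refine ⟨![1, 0], by simp, fun h => ?_⟩
  simpa [Matrix.mul_apply, Fin.sum_univ_three, stdPhi] using congrFun (congrFun h 0) 2

theorem stdPhi_one_sq (v : Fin 2 → ℝ) : stdPhi 1 v * stdPhi 1 v = 0 := by
  ext k l
  fin_cases k <;> fin_cases l <;> simp [Matrix.mul_apply, Fin.sum_univ_three, stdPhi]

theorem stdPhi_two_sq (v : Fin 2 → ℝ) : stdPhi 2 v * stdPhi 2 v = 0 := by
  ext k l
  fin_cases k <;> fin_cases l <;> simp [Matrix.mul_apply, Fin.sum_univ_three, stdPhi]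

theorem not_phiEquiv_stdPhi_one_two : ¬ PhiEquiv (stdPhi 1) (stdPhi 2) := by
  rintro ⟨P, Q, h⟩
  have key : ∀ w, ∃ v, (P : Matrix (Fin 3) (Fin 3) ℝ) * stdPhi 1 w = stdPhi 2 v * P := by
    intro w
    refine ⟨(Q⁻¹ : GL (Fin 2) ℝ).val *ᵥ w, ?_⟩
    rw [← h, mulVec_mulVec, Units.mul_inv, one_mulVec, mul_assoc, Units.inv_mul, mul_one]
  obtain ⟨v, hv⟩ := key ![1, 0]
  obtain ⟨w, hw⟩ := key ![0, 1]
  have hv1 := congrFun (congrFun hv 1) 2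
  have hv2 := congrFun (congrFun hv 2) 2
  have hw1 := congrFun (congrFun hw 1) 2
  have hw2 := congrFun (congrFun hw 2) 2
  simp [Matrix.mul_apply, Fin.sum_univ_three, stdPhi] at hv1 hv2 hw1 hw2
  have hdet : (P : Matrix (Fin 3) (Fin 3) ℝ).det ≠ 0 :=
    ((isUnit_iff_isUnit_det _).1 P.isUnit).ne_zero
  apply hdet
  rw [det_fin_three, hv1, hv2, hw1, hw2]
  ring

theorem eq_of_phiEquiv_stdPhi {i j : Fin 6} (h : PhiEquiv (stdPhi i) (stdPhi j)) : i = j := by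
  have h3 := h.exists_cubic_iff (-3) 2
  have h4 := h.exists_cubic_iff 1 0
  have h5 := h.exists_cubic_iff (-1) 0
  rw [exists_stdPhi_eigenvalue_one_iff, exists_stdPhi_eigenvalue_one_iff] at h3
  rw [exists_stdPhi_complex_eigenvalue_iff, exists_stdPhi_complex_eigenvalue_iff] at h4
  rw [exists_stdPhi_distinct_eigenvalues_iff, exists_stdPhi_distinct_eigenvalues_iff] at h5
  have h0 := h.exists_sq_ne_zero_iff
  have hs := h.symm
  fin_cases i <;> fin_cases j <;> first
    | rfl
    | (exfalso; revert h3; decide)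
    | (exfalso; revert h4; decide)
    | (exfalso; revert h5; decide)
    | exact absurd h not_phiEquiv_stdPhi_one_two
    | exact absurd hs not_phiEquiv_stdPhi_one_two
    | (obtain ⟨v, -, hv⟩ := h0.1 exists_stdPhi_zero_sq_ne_zero
       first
         | exact absurd (stdPhi_one_sq v) hv
         | exact absurd (stdPhi_two_sq v) hv)
    | (obtain ⟨v, -, hv⟩ := h0.2 exists_stdPhi_zero_sq_ne_zero
       first
         | exact absurd (stdPhi_one_sq v) hv
         | exact absurd (stdPhi_two_sq v) hv)

/-- Up to linear changes of coordinates in `ℝ³` and `ℝ²`, there are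
exactly six embeddings of the abelian Lie algebra `ℝ²` into `sl(3,ℝ)`, namely
`stdPhi 0, …, stdPhi 5`: every injective linear map `φ : ℝ² → sl(3,ℝ)` with pairwise
commuting image is equivalent to some `stdPhi i`, and no two distinct `stdPhi i`,
`stdPhi j` are equivalent to each other. -/
theorem stmt10 :
    (∀ φ : (Fin 2 → ℝ) →ₗ[ℝ] Matrix (Fin 3) (Fin 3) ℝ,
      Function.Injective φ →
      (∀ v : Fin 2 → ℝ, (φ v).trace = 0) →
      (∀ v w : Fin 2 → ℝ, φ v * φ w = φ w * φ v) →
      ∃ i : Fin 6, PhiEquiv (fun v => φ v) (stdPhi i)) ∧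
    ∀ i j : Fin 6, i ≠ j → ¬ PhiEquiv (stdPhi i) (stdPhi j) := by
  exact ⟨exists_phiEquiv_stdPhi, fun _ _ hij h => hij (eq_of_phiEquiv_stdPhi h)⟩
end

section
/- Let V be a real vector space with 1 ≤ dim V ≤ 5, and let ρ : SU(3) → GL(V) be a continuous group homomorphism. Then ρ is trivial, i.e. ρ(g) = id_V for every g ∈ SU(3). -/
open Module

/-- The special unitary group `SU(n, α)`: unitary `n × n` matrices of determinant `1`,
as a subgroup of the unitary group.  (Over `ℝ`, whose star operation is trivial, this
is the special orthogonal group `SO(n)`.) -/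
def SUgrp (n : ℕ) (α : Type) [CommRing α] [StarRing α] :
    Subgroup (Matrix.unitaryGroup (Fin n) α) where
  carrier := {A | (A : Matrix (Fin n) (Fin n) α).det = 1}
  one_mem' := by simp
  mul_mem' := by
    intro a b ha hb
    simp only [Set.mem_setOf_eq] at ha hb ⊢
    rw [Matrix.UnitaryGroup.mul_val, Matrix.det_mul, ha, hb, one_mul]
  inv_mem' := by
    intro a ha
    simp only [Set.mem_setOf_eq] at ha ⊢
    rw [Matrix.UnitaryGroup.inv_val, Matrix.star_eq_conjTranspose,
      Matrix.det_conjTranspose, ha, star_one]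

/-- A complex square matrix avoids some point of the unit circle as an eigenvalue. -/
theorem exists_unit_complex_det_sub_ne_zero {n : Type*} [Fintype n] [DecidableEq n]
    (A : Matrix n n ℂ) :
    ∃ c : ℂ, c * star c = 1 ∧ (A - Matrix.scalar n c).det ≠ 0 := by
  have hinf : (Metric.sphere (0 : ℂ) 1).Infinite := by
    refine (isPreconnected_sphere (by simp) (0 : ℂ) 1).infinite_of_nontrivial ?_
    exact ⟨1, by simp, -1, by simp, by norm_num⟩
  obtain ⟨c, hc, hc'⟩ := (hinf.sdiff A.charpoly.roots.toFinset.finite_toSet).nonempty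
  refine ⟨c, ?_, fun h => hc' ?_⟩
  · have : ‖c‖ = 1 := by simpa using hc
    simp [Complex.mul_conj, Complex.normSq_eq_norm_sq, this]
  · have h2 : (Matrix.scalar n c - A).det = 0 := by
      rw [← neg_sub, Matrix.det_neg, h, mul_zero]
    simpa [A.charpoly_monic.ne_zero, Matrix.eval_charpoly] using h2

/-- Unitary matrices are unitarily diagonalizable (via the Cayley transform). -/
theorem exists_unitary_conj_eq_diagonal {n : Type*} [Fintype n] [DecidableEq n]
    {A : Matrix n n ℂ} (hA : A ∈ Matrix.unitaryGroup n ℂ) :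
    ∃ U ∈ Matrix.unitaryGroup n ℂ, ∃ d : n → ℂ, star U * A * U = Matrix.diagonal d := by
  obtain ⟨c, hc, hdet⟩ := exists_unit_complex_det_sub_ne_zero A
  set B := A - Matrix.scalar n c with hB
  have hAA : star A * A = 1 := Matrix.mem_unitaryGroup_iff'.1 hA
  have hBu : IsUnit B.det := hdet.isUnit
  set H : Matrix n n ℂ := (Complex.I • (A + Matrix.scalar n c)) * B⁻¹ with hH
  have hHB : H * B = Complex.I • (A + Matrix.scalar n c) := by
    rw [hH, mul_assoc, Matrix.nonsing_inv_mul _ hBu, mul_one]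
  have hsB : star B = star A - Matrix.scalar n (star c) := by
    simp [hB, Matrix.star_eq_conjTranspose, Matrix.diagonal_conjTranspose, Pi.star_def]
  have hBHB : star B * star H * B = star B * H * B := by
    rw [← star_mul, mul_assoc (star B), hHB, hsB, star_smul, star_add]
    have : star (Matrix.scalar n c) = Matrix.scalar n (star c) := by
      simp [Matrix.star_eq_conjTranspose, Matrix.diagonal_conjTranspose, Pi.star_def]
    rw [this, hB]
    have e : ∀ z : ℂ, Matrix.scalar n z = z • (1 : Matrix n n ℂ) := fun z => by
      simp [Matrix.smul_one_eq_diagonal]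
    simp only [e, mul_add, add_mul, mul_sub, sub_mul, smul_mul_assoc, mul_smul_comm, hAA, one_mul,
      mul_one, smul_add, smul_smul, smul_sub]
    have e1 : star Complex.I = -Complex.I := by simp
    have e2 : star c * c = 1 := by rw [mul_comm]; exact hc
    simp only [e1]
    ext i j
    simp only [Matrix.add_apply, Matrix.sub_apply, Matrix.smul_apply, smul_eq_mul]
    linear_combination (2 * Complex.I * (1 : Matrix n n ℂ) i j) * e2
  have hHh : H.IsHermitian := by
    have hsBu : IsUnit (star B).det := by
      rw [Matrix.star_eq_conjTranspose, Matrix.det_conjTranspose]; exact hBu.star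
    have h1 := congrArg (fun M => (star B)⁻¹ * (M * B⁻¹)) hBHB
    simp only [mul_assoc, Matrix.mul_nonsing_inv _ hBu, mul_one,
      Matrix.nonsing_inv_mul_cancel_left _ _ hsBu] at h1
    exact h1
  set U := hHh.eigenvectorUnitary with hU
  refine ⟨U, U.2, fun i => (star (U : Matrix n n ℂ) * A * U) i i, ?_⟩
  have hD : star (U : Matrix n n ℂ) * H * U
      = Matrix.diagonal (fun i => ((hHh.eigenvalues i : ℝ) : ℂ)) := by
    have := hHh.conjStarAlgAut_star_eigenvectorUnitary
    rw [Unitary.conjStarAlgAut_star_apply] at this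
    exact this
  have hUU : (U : Matrix n n ℂ) * star (U : Matrix n n ℂ) = 1 := Matrix.mem_unitaryGroup_iff.1 U.2
  have hUU' : star (U : Matrix n n ℂ) * U = 1 := Matrix.mem_unitaryGroup_iff'.1 U.2
  have key : (star (U : Matrix n n ℂ) * H * U) * (star (U : Matrix n n ℂ) * A * U)
      - c • (star (U : Matrix n n ℂ) * H * U)
      = Complex.I • (star (U : Matrix n n ℂ) * A * U) + (Complex.I * c) • 1 := by
    have e : Matrix.scalar n c = c • (1 : Matrix n n ℂ) := by
      simp [Matrix.smul_one_eq_diagonal]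
    have h1 := congrArg (fun M => star (U : Matrix n n ℂ) * M * U) hHB
    simp only [hB, e, mul_sub, sub_mul, mul_add, add_mul, smul_add, mul_smul_comm, smul_mul_assoc,
      mul_one, smul_smul, hUU'] at h1
    rw [← h1]
    congr 1
    calc _ = star (U : Matrix n n ℂ) * H * ((U : Matrix n n ℂ) * star (U : Matrix n n ℂ)) * A * U := by
          simp only [mul_assoc]
      _ = _ := by rw [hUU, mul_one]; simp only [mul_assoc]
  rw [hD] at key
  ext i j
  by_cases hij : i = j
  · subst hij; simp
  · rw [Matrix.diagonal_apply_ne _ hij]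
    have h1 := congrFun (congrFun key i) j
    simp only [Matrix.sub_apply, Matrix.diagonal_mul, Matrix.smul_apply, Matrix.add_apply,
      Matrix.diagonal_apply_ne _ hij, Matrix.one_apply_ne hij, 
      smul_eq_mul] at h1
    have h2 : (((hHh.eigenvalues i : ℝ) : ℂ) - Complex.I)
        * (star (U : Matrix n n ℂ) * A * U) i j = 0 := by
      linear_combination h1
    refine (mul_eq_zero.1 h2).resolve_left fun h => ?_
    simpa using congrArg Complex.im h

namespace SUgrp

/-- Build an element of `SUgrp 3 ℂ` from a matrix. -/
def ofMatrix (M : Matrix (Fin 3) (Fin 3) ℂ) (h : M * star M = 1) (hd : M.det = 1) :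
    SUgrp 3 ℂ :=
  ⟨⟨M, Matrix.mem_unitaryGroup_iff.2 h⟩, hd⟩

/-- The underlying matrix of an element of `SUgrp 3 ℂ`. -/
def toMatrix (g : SUgrp 3 ℂ) : Matrix (Fin 3) (Fin 3) ℂ := g.1.1

theorem toMatrix_injective : Function.Injective toMatrix :=
  fun _ _ h => Subtype.ext (Subtype.ext h)

@[simp]
theorem toMatrix_ofMatrix (M : Matrix (Fin 3) (Fin 3) ℂ) (h : M * star M = 1)
    (hd : M.det = 1) : toMatrix (ofMatrix M h hd) = M := rfl

@[simp]
theorem toMatrix_mul (g h : SUgrp 3 ℂ) : toMatrix (g * h) = toMatrix g * toMatrix h := rfl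

@[simp]
theorem toMatrix_inv (g : SUgrp 3 ℂ) : toMatrix g⁻¹ = star (toMatrix g) := rfl

@[simp]
theorem toMatrix_one : toMatrix 1 = 1 := rfl

/-- The diagonal element `diag(a, b, (ab)⁻¹)` of the standard maximal torus. -/
noncomputable def diag (a b : Circle) : SUgrp 3 ℂ :=
  ofMatrix !![(a : ℂ), 0, 0; 0, b, 0; 0, 0, ((a * b)⁻¹ : Circle)]
    (by
      ext i j
      fin_cases i <;> fin_cases j <;>
        simp [Matrix.mul_apply, Fin.sum_univ_three, Matrix.star_apply, ← Circle.coe_inv_eq_conj]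
      field_simp)
    (by
      simp [Matrix.det_fin_three]
      field_simp)

theorem toMatrix_diag (a b : Circle) :
    toMatrix (diag a b) = !![(a : ℂ), 0, 0; 0, b, 0; 0, 0, ((a * b)⁻¹ : Circle)] := rfl

/-- The cyclic permutation matrix. -/
def cycle : SUgrp 3 ℂ :=
  ofMatrix !![0, 0, 1; 1, 0, 0; 0, 1, 0]
    (by
      ext i j
      fin_cases i <;> fin_cases j <;>
        simp [Matrix.mul_apply, Fin.sum_univ_three, Matrix.star_apply])
    (by simp [Matrix.det_fin_three])

theorem toMatrix_cycle : toMatrix cycle = !![0, 0, 1; 1, 0, 0; 0, 1, 0] := rfl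

theorem ofReal_half_sqrt_two_mul_self :
    ((√2 / 2 : ℝ) : ℂ) * ((√2 / 2 : ℝ) : ℂ) = 1 / 2 := by
  have : √2 / 2 * (√2 / 2) = 1 / 2 := by
    nlinarith [Real.mul_self_sqrt (show (0 : ℝ) ≤ 2 by norm_num)]
  rw [← Complex.ofReal_mul, this]
  norm_num

/-- A real rotation by `π / 4` in the first two coordinates. -/
noncomputable def eighthTurn : SUgrp 3 ℂ :=
  ofMatrix !![((√2 / 2 : ℝ) : ℂ), -((√2 / 2 : ℝ) : ℂ), 0;
      ((√2 / 2 : ℝ) : ℂ), ((√2 / 2 : ℝ) : ℂ), 0; 0, 0, 1]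
    (by
      ext i j
      fin_cases i <;> fin_cases j <;>
        simp [-Complex.ofReal_div, Matrix.mul_apply, Fin.sum_univ_three, Matrix.star_apply,
          ofReal_half_sqrt_two_mul_self] <;>
        norm_num)
    (by
      simp [-Complex.ofReal_div, Matrix.det_fin_three, ofReal_half_sqrt_two_mul_self]
      norm_num)

theorem toMatrix_eighthTurn :
    toMatrix eighthTurn = !![((√2 / 2 : ℝ) : ℂ), -((√2 / 2 : ℝ) : ℂ), 0;
      ((√2 / 2 : ℝ) : ℂ), ((√2 / 2 : ℝ) : ℂ), 0; 0, 0, 1] := rfl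

theorem diag_mul_diag (a b c d : Circle) : diag a b * diag c d = diag (a * c) (b * d) := by
  apply toMatrix_injective
  ext i j
  fin_cases i <;> fin_cases j <;>
    simp [toMatrix_diag, Matrix.mul_apply, Fin.sum_univ_three]
  ring

theorem diag_one_one : diag 1 1 = 1 := by
  apply toMatrix_injective
  ext i j
  fin_cases i <;> fin_cases j <;> simp [toMatrix_diag]

theorem diag_inv (a b : Circle) : (diag a b)⁻¹ = diag a⁻¹ b⁻¹ :=
  inv_eq_of_mul_eq_one_right (by simp [diag_mul_diag, diag_one_one])

theorem cycle_mul_diag (a b : Circle) : cycle * diag a b = diag (a * b)⁻¹ a * cycle := by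
  apply toMatrix_injective
  ext i j
  fin_cases i <;> fin_cases j <;>
    simp [toMatrix_diag, toMatrix_cycle, Matrix.mul_apply, Fin.sum_univ_three]

/-- Conjugating `diag(1, -1, -1)` by the eighth turn gives a signed transposition of the first
two coordinates. -/
theorem toMatrix_conj_eighthTurn :
    toMatrix (eighthTurn * diag 1 (-1) * eighthTurn⁻¹) = !![0, 1, 0; 1, 0, 0; 0, 0, -1] := by
  ext i j
  fin_cases i <;> fin_cases j <;>
    simp [-Complex.ofReal_div, toMatrix_diag, toMatrix_eighthTurn, Matrix.mul_apply,
      Fin.sum_univ_three, Matrix.star_apply, ofReal_half_sqrt_two_mul_self] <;>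
    norm_num

theorem conj_eighthTurn_mul_diag (z : Circle) :
    eighthTurn * diag 1 (-1) * eighthTurn⁻¹ * diag z z⁻¹ =
      diag z⁻¹ z * (eighthTurn * diag 1 (-1) * eighthTurn⁻¹) := by
  apply toMatrix_injective
  rw [toMatrix_mul _ (diag z _), toMatrix_mul (diag _ z), toMatrix_conj_eighthTurn]
  ext i j
  fin_cases i <;> fin_cases j <;>
    simp [toMatrix_diag, Matrix.mul_apply, Fin.sum_univ_three]

theorem diag_mem_of_normal {N : Subgroup (SUgrp 3 ℂ)} [hN : N.Normal]
    (h : diag 1 (-1) ∈ N) (a b : Circle) : diag a b ∈ N := by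
  have h₁ : ∀ z, diag z z⁻¹ ∈ N := fun z => by
    obtain ⟨x, rfl⟩ : ∃ x : Circle, x * x = z := by
      obtain ⟨t, rfl⟩ := Circle.exp_surjective z
      exact ⟨Circle.exp (t / 2), by rw [← Circle.exp_add]; ring_nf⟩
    have hw := hN.conj_mem _ h eighthTurn
    have hc : diag x x⁻¹ * (eighthTurn * diag 1 (-1) * eighthTurn⁻¹) * (diag x x⁻¹)⁻¹ *
        (eighthTurn * diag 1 (-1) * eighthTurn⁻¹)⁻¹ ∈ N :=
      N.mul_mem (hN.conj_mem _ hw _) (N.inv_mem hw)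
    have := conj_eighthTurn_mul_diag x⁻¹
    rw [inv_inv] at this
    rwa [diag_inv, inv_inv, mul_assoc (diag x x⁻¹), this, mul_assoc, mul_assoc,
      mul_inv_cancel, mul_one, diag_mul_diag, ← mul_inv] at hc
  have h₂ : ∀ z, diag 1 z ∈ N := fun z => by
    have := hN.conj_mem _ (h₁ z) cycle
    rwa [cycle_mul_diag, mul_inv_cancel_right, mul_inv_cancel, inv_one] at this
  have := N.mul_mem (h₁ a) (h₂ (a * b))
  rwa [diag_mul_diag, mul_one, inv_mul_cancel_left] at this

/-- Every element of `SU(3)` is conjugate in `SU(3)` to an element of the diagonal torus. -/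
theorem exists_conj_eq_diag (g : SUgrp 3 ℂ) : ∃ u a b, u⁻¹ * g * u = diag a b := by
  obtain ⟨U, hU, d, hd⟩ := exists_unitary_conj_eq_diagonal g.1.2
  change star U * toMatrix g * U = _ at hd
  have hUU := Matrix.mem_unitaryGroup_iff.1 hU
  have hdet : U.det * star U.det = 1 := by
    simpa [Matrix.star_eq_conjTranspose, Matrix.det_conjTranspose] using congrArg Matrix.det hUU
  set D : Matrix (Fin 3) (Fin 3) ℂ := Matrix.diagonal ![star U.det, 1, 1] with hD
  have hDs : star D = Matrix.diagonal ![U.det, 1, 1] := by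
    rw [hD, Matrix.star_eq_conjTranspose, Matrix.diagonal_conjTranspose]
    congr 1
    ext i; fin_cases i <;> simp
  have hDD : D * star D = 1 := by
    rw [hDs, hD, Matrix.diagonal_mul_diagonal, ← Matrix.diagonal_one]
    congr 1
    ext i; fin_cases i <;> simp
    simpa [mul_comm] using hdet
  have hDdet : D.det = star U.det := by simp [hD, Fin.prod_univ_three]
  set u : SUgrp 3 ℂ := ofMatrix (U * D)
    (by rw [star_mul, mul_assoc, ← mul_assoc D, hDD, one_mul, hUU])
    (by rw [Matrix.det_mul, hDdet, hdet]) with hu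
  have key : toMatrix (u⁻¹ * g * u) = Matrix.diagonal d := by
    have : toMatrix (u⁻¹ * g * u) = star D * (star U * toMatrix g * U) * D := by
      simp only [toMatrix_mul, toMatrix_inv, hu, toMatrix_ofMatrix, star_mul, mul_assoc]
    rw [this, hd, hDs, hD, Matrix.diagonal_mul_diagonal, Matrix.diagonal_mul_diagonal]
    congr 1
    ext i; fin_cases i <;> simp
    rw [starRingEnd_apply]
    linear_combination d 0 * hdet
  have hunit : ∀ i, d i * star (d i) = 1 := fun i => by
    have h1 := Matrix.mem_unitaryGroup_iff.1 (u⁻¹ * g * u).1.2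
    change toMatrix (u⁻¹ * g * u) * star (toMatrix (u⁻¹ * g * u)) = 1 at h1
    rw [key, Matrix.star_eq_conjTranspose, Matrix.diagonal_conjTranspose,
      Matrix.diagonal_mul_diagonal] at h1
    simpa using congrFun (congrFun h1 i) i
  have hnorm : ∀ i, ‖d i‖ = 1 := fun i => by
    have h1 := congrArg norm (hunit i)
    rw [norm_mul, norm_star, norm_one] at h1
    nlinarith [norm_nonneg (d i)]
  have hprod : d 0 * d 1 * d 2 = 1 := by
    have h1 : (toMatrix (u⁻¹ * g * u)).det = 1 := (u⁻¹ * g * u).2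
    simpa [key, Fin.prod_univ_three] using h1
  have hcirc : ∀ i, ∃ a : Circle, (a : ℂ) = d i := fun i =>
    ⟨⟨d i, mem_sphere_zero_iff_norm.2 (hnorm i)⟩, rfl⟩
  obtain ⟨a, ha⟩ := hcirc 0
  obtain ⟨b, hb⟩ := hcirc 1
  refine ⟨u, a, b, toMatrix_injective ?_⟩
  rw [key, toMatrix_diag]
  have h2 : (d 1)⁻¹ * (d 0)⁻¹ = d 2 := by
    rw [← mul_inv, mul_comm]
    exact inv_eq_of_mul_eq_one_right hprod
  ext i j
  fin_cases i <;> fin_cases j <;> simp [h2, ha, hb]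

theorem eq_top_of_diag_mem {N : Subgroup (SUgrp 3 ℂ)} [hN : N.Normal]
    (h : diag 1 (-1) ∈ N) : N = ⊤ := by
  refine (Subgroup.eq_top_iff' N).2 fun g => ?_
  obtain ⟨u, a, b, hu⟩ := exists_conj_eq_diag g
  have := hN.conj_mem _ (diag_mem_of_normal h a b) u
  rw [← hu] at this
  simpa [mul_assoc] using this

/-- In a real representation of `SU(3)` of dimension at most `5`, no nonzero vector transforms
under the sign matrices by the character `diag(1, -1, -1) ↦ 1`, `diag(-1, 1, -1) ↦ -1`. -/
theorem eq_zero_of_apply_diag {V : Type*} [AddCommGroup V] [Module ℝ V] [FiniteDimensional ℝ V]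
    (hV : finrank ℝ V ≤ 5) (f : SUgrp 3 ℂ →* Module.End ℝ V) {x : V}
    (h₁ : f (diag 1 (-1)) x = x) (h₂ : f (diag (-1) 1) x = -x) : x = 0 := by
  have hmul : ∀ g h y, f g (f h y) = f (g * h) y := fun g h y => by
    rw [map_mul, Module.End.mul_apply]
  set W : Submodule ℝ V :=
    LinearMap.ker (f (diag 1 (-1)) - 1) ⊓ LinearMap.ker (f (diag (-1) 1) + 1) with hW
  have hmem : ∀ y, y ∈ W ↔ f (diag 1 (-1)) y = y ∧ f (diag (-1) 1) y = -y := fun y => by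
    simp [hW, sub_eq_zero, add_eq_zero_iff_eq_neg]
  have hP₁ : ∀ y, f (diag (-1) 1) (f cycle y) = f cycle (f (diag 1 (-1)) y) := fun y => by
    rw [hmul, hmul, cycle_mul_diag]; simp
  have hP₂ : ∀ y, f (diag 1 (-1)) (f cycle y) =
      f cycle (f (diag 1 (-1)) (f (diag (-1) 1) y)) := fun y => by
    rw [hmul, hmul, hmul, mul_assoc, diag_mul_diag, cycle_mul_diag]; simp
  have hPinj : Function.Injective (f cycle) := fun y z h => by
    have := congrArg (f cycle⁻¹) h
    simpa [hmul] using this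
  let φ : W × W × W →ₗ[ℝ] V :=
    W.subtype.coprod ((f cycle ∘ₗ W.subtype).coprod (f cycle ∘ₗ f cycle ∘ₗ W.subtype))
  have hφ : Function.Injective φ := by
    rw [injective_iff_map_eq_zero]
    rintro ⟨⟨x, hx⟩, ⟨y, hy⟩, ⟨z, hz⟩⟩ h
    rw [hmem] at hx hy hz
    replace h : x + (f cycle y + f cycle (f cycle z)) = 0 := h
    have hA := congrArg (f (diag 1 (-1))) h
    have hB := congrArg (f (diag (-1) 1)) h
    simp only [map_add, hP₁, hP₂, hx.1, hx.2, hy.1, hy.2, hz.1, hz.2, map_neg, map_zero] at hA hB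
    have hx0 : x = 0 := by
      have : (2 : ℝ) • x = 0 := by linear_combination (norm := module) h + hA
      simpa using this
    have hy0 : f cycle y = 0 := by
      have : (2 : ℝ) • f cycle y = 0 := by linear_combination (norm := module) h + hB
      simpa using this
    have hz0 : f cycle (f cycle z) = 0 := by simpa [hx0, hy0] using h
    simp only [map_eq_zero_iff _ hPinj] at hy0 hz0
    simp [hx0, hy0, hz0]
  have hrank : finrank ℝ W ≤ 1 := by
    have := LinearMap.finrank_le_finrank_of_injective hφ
    rw [Module.finrank_prod, Module.finrank_prod] at this
    omega
  by_contra hx0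
  have hxW : x ∈ W := (hmem x).2 ⟨h₁, h₂⟩
  obtain ⟨i, hi⟩ : ∃ i : Circle, i * i = -1 :=
    ⟨Circle.exp (Real.pi / 2), by
      rw [← Circle.exp_add, add_halves]; ext; simp⟩
  have htW : f (diag i 1) x ∈ W := by
    rw [hmem, hmul, hmul, diag_mul_diag, diag_mul_diag, mul_comm 1 i, mul_comm (-1) i,
      mul_comm (-1 : Circle) 1, ← diag_mul_diag, ← diag_mul_diag, ← hmul, ← hmul, h₁, h₂, map_neg]
    exact ⟨rfl, rfl⟩
  obtain ⟨v, hv⟩ := finrank_le_one_iff.1 hrank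
  obtain ⟨c, hc⟩ := hv ⟨x, hxW⟩
  obtain ⟨e, he⟩ := hv ⟨_, htW⟩
  replace hc : c • (v : V) = x := congrArg Subtype.val hc
  replace he : e • (v : V) = f (diag i 1) x := congrArg Subtype.val he
  have hc0 : c ≠ 0 := by rintro rfl; exact hx0 (by rw [← hc, zero_smul])
  have ht : f (diag i 1) x = (e / c) • x := by
    rw [← he, ← hc, smul_smul, div_mul_cancel₀ _ hc0]
  have ht2 : f (diag i 1) (f (diag i 1) x) = -x := by
    rw [hmul, diag_mul_diag, hi, mul_one, h₂]
  rw [ht, map_smul, ht, smul_smul] at ht2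
  have : (e / c * (e / c) + 1) • x = 0 := by rw [add_smul, ht2, one_smul, neg_add_cancel]
  rcases smul_eq_zero.1 this with h | h
  · nlinarith [mul_self_nonneg (e / c)]
  · exact hx0 h

/-- In a real representation of `SU(3)` of dimension at most `5`, the sign matrix
`diag(1, -1, -1)` acts trivially. -/
theorem map_diag_eq_one {V : Type*} [AddCommGroup V] [Module ℝ V] [FiniteDimensional ℝ V]
    (hV : finrank ℝ V ≤ 5) (f : SUgrp 3 ℂ →* Module.End ℝ V) : f (diag 1 (-1)) = 1 := by
  have hmul : ∀ g h y, f g (f h y) = f (g * h) y := fun g h y => by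
    rw [map_mul, Module.End.mul_apply]
  have hAB : ∀ y, f (diag 1 (-1)) y - f (diag (-1) 1) y + y - f (diag (-1) (-1)) y = 0 :=
    fun y => by
      apply eq_zero_of_apply_diag hV f <;>
      · simp only [map_add, map_sub, hmul, diag_mul_diag, mul_one, one_mul, neg_mul_neg,
          diag_one_one, map_one, Module.End.one_apply]
        abel
  have hP : ∀ a b y, f (diag (a * b)⁻¹ a) (f cycle y) = f cycle (f (diag a b) y) :=
    fun a b y => by rw [hmul, hmul, cycle_mul_diag]
  have hPinj : Function.Injective (f cycle) := fun y z h => by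
    have := congrArg (f cycle⁻¹) h
    simpa [hmul] using this
  have hP₁ := hP 1 (-1)
  have hP₂ := hP (-1) 1
  have hP₃ := hP (-1) (-1)
  simp only [one_mul, mul_one, neg_mul_neg, inv_neg, inv_one] at hP₁ hP₂ hP₃
  have hB : ∀ y, f (diag (-1) 1) y = y := fun y => by
    have h := hAB (f cycle y)
    rw [hP₁, hP₂, hP₃, ← map_sub, ← map_add, ← map_sub, map_eq_zero_iff _ hPinj] at h
    have h2 : (2 : ℝ) • (f (diag (-1) 1) y - y) = 0 := by
      linear_combination (norm := module) -hAB y - h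
    simpa [sub_eq_zero] using h2
  ext y
  exact hPinj (by rw [← hP₁, hB, Module.End.one_apply])

end SUgrp

/-- Let `V` be a real vector space with `1 ≤ dim V ≤ 5` and let
`ρ : SU(3) → GL(V)` be a continuous group homomorphism (continuity being stated via
the standard operator-norm topology on endomorphisms of `V`).  Then `ρ` is trivial:
`ρ(g) = id` for every `g ∈ SU(3)`. -/
theorem stmt16
    (V : Type) [NormedAddCommGroup V] [NormedSpace ℝ V] [FiniteDimensional ℝ V]
    (hd1 : 1 ≤ finrank ℝ V) (hd5 : finrank ℝ V ≤ 5)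
    (ρ : SUgrp 3 ℂ →* (V →ₗ[ℝ] V)ˣ)
    (hcont : Continuous fun g : SUgrp 3 ℂ =>
      LinearMap.toContinuousLinearMap ((ρ g : V →ₗ[ℝ] V))) :
    ∀ g : SUgrp 3 ℂ, ρ g = 1 := by
  have hker : ρ.ker = ⊤ := SUgrp.eq_top_of_diag_mem <| Units.ext <|
    SUgrp.map_diag_eq_one hd5 ((Units.coeHom (Module.End ℝ V)).comp ρ)
  exact fun g => MonoidHom.mem_ker.1 (hker ▸ Subgroup.mem_top g)
end

section
/- All copies of SO(3) inside SU(3) are conjugate: if H₁ and H₂ are subgroups of SU(3) each of which, with the subspace topology, is isomorphic as a topological group to SO(3), then there exists u ∈ SU(3) with u·H₁·u⁻¹ = H₂. -/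
open Matrix

theorem exists_unitary_conj_klein (A C : Matrix (Fin 3) (Fin 3) ℂ) (hA : Aᴴ = A) (hC : Cᴴ = C)
    (hAA : A * A = 1) (hCC : C * C = 1) (hAC : A * C = C * A) (hdA : A.det = 1) (hdC : C.det = 1)
    (hA1 : A ≠ 1) (hC1 : C ≠ 1) (hne : A ≠ C) :
    ∃ U : Matrix (Fin 3) (Fin 3) ℂ, Uᴴ * U = 1 ∧ U * Uᴴ = 1 ∧
      Uᴴ * A * U = diagonal ![1, -1, -1] ∧ Uᴴ * C * U = diagonal ![-1, -1, 1] := by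
  have hM : (A + (2 : ℂ) • C).IsHermitian := by
    rw [IsHermitian, conjTranspose_add, conjTranspose_smul, hA, hC]; simp
  obtain ⟨V, D, hV1, hV2, hD⟩ : ∃ (V : Matrix (Fin 3) (Fin 3) ℂ) (D : Fin 3 → ℂ),
      Vᴴ * V = 1 ∧ V * Vᴴ = 1 ∧ Vᴴ * (A + (2 : ℂ) • C) * V = diagonal D := by
    refine ⟨hM.eigenvectorUnitary, (fun i => (hM.eigenvalues i : ℂ)), ?_, ?_, ?_⟩
    · exact (mem_unitaryGroup_iff'.1 hM.eigenvectorUnitary.2)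
    · exact (mem_unitaryGroup_iff.1 hM.eigenvectorUnitary.2)
    · have := hM.conjStarAlgAut_star_eigenvectorUnitary
      simpa [Unitary.conjStarAlgAut_apply, Function.comp_def, star_eq_conjTranspose] using this
  set A' := Vᴴ * A * V with hA'
  set C' := Vᴴ * C * V with hC'
  have conj_mul (X Y : Matrix (Fin 3) (Fin 3) ℂ) :
      (Vᴴ * X * V) * (Vᴴ * Y * V) = Vᴴ * (X * Y) * V := by
    calc _ = Vᴴ * X * (V * Vᴴ) * Y * V := by simp only [mul_assoc]
      _ = _ := by rw [hV2]; simp only [mul_assoc, mul_one]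
  have hAA' : A' * A' = 1 := by rw [conj_mul, hAA, mul_one, hV1]
  have hCC' : C' * C' = 1 := by rw [conj_mul, hCC, mul_one, hV1]
  have hAC' : A' * C' = C' * A' := by rw [conj_mul, conj_mul, hAC]
  have hD' : A' + (2 : ℂ) • C' = diagonal D := by
    rw [← hD, hA', hC']; simp [mul_add, add_mul]
  have back (X : Matrix (Fin 3) (Fin 3) ℂ) : V * (Vᴴ * X * V) * Vᴴ = X := by
    calc _ = (V * Vᴴ) * X * (V * Vᴴ) := by simp only [mul_assoc]
      _ = _ := by rw [hV2]; simp
  have det_conj (X : Matrix (Fin 3) (Fin 3) ℂ) : (Vᴴ * X * V).det = X.det := by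
    have : V.det * Vᴴ.det = 1 := by rw [← det_mul, hV2, det_one]
    rw [det_mul, det_mul]; linear_combination X.det * this
  have hdA' : A'.det = 1 := by rw [det_conj, hdA]
  have hdC' : C'.det = 1 := by rw [det_conj, hdC]
  have hA1' : A' ≠ 1 := fun h => hA1 (by rw [← back A, ← hA', h, mul_one, hV2])
  have hC1' : C' ≠ 1 := fun h => hC1 (by rw [← back C, ← hC', h, mul_one, hV2])
  have hne' : A' ≠ C' := fun h => hne (by rw [← back A, ← back C, ← hA', ← hC', h])
  clear_value A' C'
  have hE : (4 : ℂ) • (A' * C') = diagonal (fun i => D i * D i - 5) := by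
    have : diagonal D * diagonal D = (5 : ℂ) • 1 + (4 : ℂ) • (A' * C') := by
      rw [← hD', add_mul, mul_add, mul_add, hAA']
      simp only [mul_smul_comm, smul_mul_assoc, hCC', ← hAC']
      module
    rw [diagonal_mul_diagonal] at this
    rw [← sub_eq_iff_eq_add'] at this
    rw [← this]
    ext i j
    by_cases h : i = j <;> simp [h, diagonal]
  have hA4 : (-12 : ℂ) • A' = diagonal (fun i => D i * (4 - 2 * (D i * D i - 5))) := by
    have h1 : diagonal D * ((4 : ℂ) • 1 - (2 : ℂ) • ((4 : ℂ) • (A' * C'))) = (-12 : ℂ) • A' := by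
      rw [← hD', add_mul, mul_sub, mul_sub]
      simp only [mul_smul_comm, smul_mul_assoc, mul_one]
      rw [← mul_assoc, hAA', hAC', ← mul_assoc, hCC', one_mul, one_mul]
      module
    rw [← h1, hE]
    have : ((4 : ℂ) • (1 : Matrix (Fin 3) (Fin 3) ℂ) - (2 : ℂ) • diagonal (fun i => D i * D i - 5)) =
        diagonal (fun i => 4 - 2 * (D i * D i - 5)) := by
      ext i j
      by_cases h : i = j <;> simp [h, diagonal]
    rw [this, diagonal_mul_diagonal]
  obtain ⟨a, ha⟩ : ∃ a, A' = diagonal a := by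
    refine ⟨fun i => (-12 : ℂ)⁻¹ * (D i * (4 - 2 * (D i * D i - 5))), ?_⟩
    rw [← inv_smul_smul₀ (show (-12 : ℂ) ≠ 0 by norm_num) A', hA4]
    ext i j
    by_cases h : i = j <;> simp [h, diagonal]
  obtain ⟨c, hc⟩ : ∃ c, C' = diagonal c := by
    refine ⟨fun i => (2 : ℂ)⁻¹ * (D i - a i), ?_⟩
    have : (2 : ℂ) • C' = diagonal D - diagonal a := by rw [← hD', ha]; module
    rw [← inv_smul_smul₀ (show (2 : ℂ) ≠ 0 by norm_num) C', this]
    ext i j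
    by_cases h : i = j <;> simp [h, diagonal]
  have sgn (x : Fin 3 → ℂ) (h : diagonal x * diagonal x = 1) (i : Fin 3) : x i = 1 ∨ x i = -1 := by
    rw [diagonal_mul_diagonal] at h
    have := congr_fun₂ h i i
    simp only [diagonal_apply_eq, one_apply_eq] at this
    exact mul_self_eq_one_iff.1 this
  have sa := sgn a (by rw [← ha, hAA'])
  have sc := sgn c (by rw [← hc, hCC'])
  rw [ha, det_diagonal, Fin.prod_univ_three] at hdA'
  rw [hc, det_diagonal, Fin.prod_univ_three] at hdC'
  obtain ⟨σ, hσa, hσc⟩ : ∃ σ : Equiv.Perm (Fin 3), a ∘ σ = ![1, -1, -1] ∧ c ∘ σ = ![-1, -1, 1] := by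
    have e (x y : Fin 3 → ℂ) (h0 : x 0 = y 0) (h1 : x 1 = y 1) (h2 : x 2 = y 2) : x = y := by
      ext i; fin_cases i <;> assumption
    have hA2 : ¬ (a 0 = 1 ∧ a 1 = 1 ∧ a 2 = 1) := fun h => hA1' (by
      rw [ha, ← diagonal_one, e a (fun _ => 1) h.1 h.2.1 h.2.2])
    have hC2 : ¬ (c 0 = 1 ∧ c 1 = 1 ∧ c 2 = 1) := fun h => hC1' (by
      rw [hc, ← diagonal_one, e c (fun _ => 1) h.1 h.2.1 h.2.2])
    have hn2 : ¬ (a 0 = c 0 ∧ a 1 = c 1 ∧ a 2 = c 2) := fun h => hne' (by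
      rw [ha, hc, e a c h.1 h.2.1 h.2.2])
    have key (i j k : Fin 3) (σ : Equiv.Perm (Fin 3)) (h0 : σ 0 = i) (h1 : σ 1 = j) (h2 : σ 2 = k)
        (hi : a i = 1 ∧ c i = -1) (hj : a j = -1 ∧ c j = -1) (hk : a k = -1 ∧ c k = 1) :
        ∃ σ : Equiv.Perm (Fin 3), a ∘ σ = ![1, -1, -1] ∧ c ∘ σ = ![-1, -1, 1] := by
      refine ⟨σ, e _ _ ?_ ?_ ?_, e _ _ ?_ ?_ ?_⟩ <;> simp [h0, h1, h2, hi, hj, hk]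
    have k012 := key 0 1 2 1 rfl rfl rfl
    have k021 := key 0 2 1 (Equiv.swap 1 2) rfl rfl rfl
    have k102 := key 1 0 2 (Equiv.swap 0 1) rfl rfl rfl
    have k210 := key 2 1 0 (Equiv.swap 0 2) rfl rfl rfl
    have k120 := key 1 2 0 (Equiv.swap 0 1 * Equiv.swap 1 2) (by decide) (by decide) (by decide)
    have k201 := key 2 0 1 (Equiv.swap 0 2 * Equiv.swap 1 2) (by decide) (by decide) (by decide)
    clear key e
    have n1 : (-1 : ℂ) ≠ 1 := by norm_num
    rcases sa 0 with h0 | h0 <;> rcases sa 1 with h1 | h1 <;> rcases sa 2 with h2 | h2 <;>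
    simp only [h0, h1, h2, mul_neg, mul_one, neg_neg, n1, not_true, and_true, true_and]
      at hdA' hA2 <;>
    rcases sc 0 with g0 | g0 <;> rcases sc 1 with g1 | g1 <;> rcases sc 2 with g2 | g2 <;>
    simp only [h0, h1, h2, g0, g1, g2, mul_neg, mul_one, neg_neg, n1, n1.symm, not_true,
      not_false_iff, and_true, and_self, forall_const, and_false, false_implies]
      at hdC' hC2 hn2 k012 k021 k102 k210 k120 k201 <;>
    assumption
  have sub (X : Matrix (Fin 3) (Fin 3) ℂ) :
      (V.submatrix id σ)ᴴ * X * V.submatrix id σ = (Vᴴ * X * V).submatrix σ σ := by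
    rw [conjTranspose_submatrix]; rfl
  refine ⟨V.submatrix id σ, ?_, ?_, ?_, ?_⟩
  · rw [← mul_one (V.submatrix id σ)ᴴ, sub, mul_one, hV1, submatrix_one_equiv]
  · rw [conjTranspose_submatrix, submatrix_mul_equiv, hV2, submatrix_id_id]
  · rw [sub, ← hA', ha, submatrix_diagonal_equiv, hσa]
  · rw [sub, ← hC', hc, submatrix_diagonal_equiv, hσc]

theorem exists_range_eq_rotations (T : ℝ → Matrix (Fin 3) (Fin 3) ℂ) (hc : Continuous T)
    (h0 : T 0 = 1) (hpi : T Real.pi = diagonal ![-1, -1, 1])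
    (hadd : ∀ x y, T (x + y) = T x * T y) (hstar : ∀ x, (T x)ᴴ = T (-x))
    (hdet : ∀ x, (T x).det = 1)
    (hconj : ∀ x, diagonal ![1, -1, -1] * T x = T (-x) * diagonal ![1, -1, -1]) :
    ∃ w : ℂ, w * star w = 1 ∧ ∀ M, (∃ x, T x = M) ↔ ∃ a s : ℝ, a ^ 2 + s ^ 2 = 1 ∧
      M = !![(a : ℂ), s * w, 0; -(s * star w), a, 0; 0, 0, 1] := by
  have hcomm (x y) : T x * T y = T y * T x := by rw [← hadd, add_comm, hadd]
  have hun (x) : T x * (T x)ᴴ = 1 := by rw [hstar, ← hadd, add_neg_cancel, h0]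
  have hz (x) : T x 0 2 = 0 ∧ T x 1 2 = 0 ∧ T x 2 0 = 0 ∧ T x 2 1 = 0 := by
    have h := hcomm x Real.pi
    rw [hpi] at h
    have a1 := congr_fun₂ h 0 2
    have a2 := congr_fun₂ h 1 2
    have a3 := congr_fun₂ h 2 0
    have a4 := congr_fun₂ h 2 1
    simp [mul_diagonal, diagonal_mul] at a1 a2 a3 a4
    refine ⟨?_, ?_, ?_, ?_⟩
    · linear_combination a1 / 2
    · linear_combination a2 / 2
    · linear_combination -a3 / 2
    · linear_combination -a4 / 2
  have hs (x) : star (T x 0 0) = T x 0 0 ∧ star (T x 1 1) = T x 1 1 ∧ star (T x 2 2) = T x 2 2 ∧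
      T x 1 0 = - star (T x 0 1) := by
    have h := hconj x
    rw [← hstar] at h
    have a1 := congr_fun₂ h 0 0
    have a2 := congr_fun₂ h 1 1
    have a3 := congr_fun₂ h 2 2
    have a4 := congr_fun₂ h 1 0
    simp [mul_diagonal, diagonal_mul] at a1 a2 a3 a4
    simp only [RCLike.star_def]
    refine ⟨a1.symm, a2.symm, a3.symm, ?_⟩
    linear_combination -a4
  have hq (x) : T x 2 2 = 1 := by
    have h1 : T x 2 2 = T (x / 2) 2 2 * T (x / 2) 2 2 := by
      conv_lhs => rw [← add_halves x, hadd]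
      simp [mul_apply, Fin.sum_univ_three, hz]
    have h2 := congr_fun₂ (hun (x / 2)) 2 2
    simp only [mul_apply, Fin.sum_univ_three, hz, conjTranspose_apply, hs, one_apply_eq] at h2
    rw [h1]; linear_combination h2
  have heq (x) : T x 0 0 = T x 1 1 ∧ T x 0 0 * T x 0 0 + T x 0 1 * star (T x 0 1) = 1 := by
    have h1 := congr_fun₂ (hun x) 0 0
    have h2 := congr_fun₂ (hun x) 1 1
    have h3 := hdet x
    simp only [mul_apply, Fin.sum_univ_three, hz, conjTranspose_apply, hs, one_apply_eq,
      star_neg, star_star] at h1 h2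
    rw [det_fin_three] at h3
    simp only [hz, hs, hq] at h3
    refine ⟨?_, by linear_combination h1⟩
    have : (T x 0 0 - T x 1 1) * (T x 0 0 - T x 1 1) = 0 := by
      linear_combination h1 + h2 - 2 * h3
    exact sub_eq_zero.1 (mul_self_eq_zero.1 this)
  have hform (x) : T x = !![T x 0 0, T x 0 1, 0; -star (T x 0 1), T x 0 0, 0; 0, 0, 1] := by
    ext i j
    fin_cases i <;> fin_cases j <;> simp [hz, hq, ← (heq x).1]
    exact (hs x).2.2.2
  have hre (x) : ((T x 0 0).re : ℂ) = T x 0 0 := Complex.conj_eq_iff_re.1 (hs x).1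
  have hcre : Continuous fun x => (T x 0 0).re :=
    Complex.continuous_re.comp (hc.matrix_elem 0 0)
  have hivt (a : ℝ) (h1 : -1 ≤ a) (h2 : a ≤ 1) : ∃ x, (T x 0 0).re = a := by
    have := intermediate_value_univ Real.pi 0 hcre
    simp only [hpi, h0] at this
    exact this (by simpa using ⟨h1, h2⟩)
  obtain ⟨x₀, hx₀⟩ := hivt 0 (by norm_num) (by norm_num)
  have hx₀' : T x₀ 0 0 = 0 := by rw [← hre, hx₀]; simp
  have hw : T x₀ 0 1 * star (T x₀ 0 1) = 1 := by simpa [hx₀'] using (heq x₀).2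
  have hreal (x) : ∃ s : ℝ, T x 0 1 = s * T x₀ 0 1 ∧ (T x 0 0).re ^ 2 + s ^ 2 = 1 := by
    have h := congr_fun₂ (hcomm x x₀) 0 0
    simp only [mul_apply, Fin.sum_univ_three, hz, hs, hx₀'] at h
    have h' : star (T x 0 1 * star (T x₀ 0 1)) = T x 0 1 * star (T x₀ 0 1) := by
      rw [star_mul, star_star]; linear_combination h
    have h'' := Complex.conj_eq_iff_re.1 h'
    refine ⟨(T x 0 1 * star (T x₀ 0 1)).re, ?_, ?_⟩
    · rw [h'']; linear_combination -T x 0 1 * hw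
    · apply Complex.ofReal_injective
      push_cast
      rw [h'', hre]
      rw [star_mul, star_star] at h'
      linear_combination (heq x).2 - T x 0 1 * star (T x₀ 0 1) * h' + T x 0 1 * star (T x 0 1) * hw
  refine ⟨T x₀ 0 1, hw, fun M => ⟨?_, ?_⟩⟩
  · rintro ⟨x, rfl⟩
    obtain ⟨s, hs1, hs2⟩ := hreal x
    refine ⟨_, s, hs2, ?_⟩
    rw [hre]
    conv_lhs => rw [hform x, hs1]
    simp
  · rintro ⟨a, s, has, rfl⟩
    obtain ⟨x, hx⟩ := hivt a (by nlinarith) (by nlinarith)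
    obtain ⟨t, ht1, ht2⟩ := hreal x
    have : t = s ∨ t = -s := sq_eq_sq_iff_eq_or_eq_neg.1 (by rw [hx] at ht2; linarith)
    rcases this with rfl | rfl
    · refine ⟨x, ?_⟩
      rw [hform x, ht1, ← hre, hx]; simp
    · refine ⟨-x, ?_⟩
      rw [← hstar, hform x, ht1, ← hre, hx]
      ext i j
      fin_cases i <;> fin_cases j <;> simp

/-- The matrix of the rotation by `θ` in the plane of the first two coordinates. -/
noncomputable def rotMatrix (θ : ℝ) : Matrix (Fin 3) (Fin 3) ℝ :=
  !![Real.cos θ, Real.sin θ, 0; -Real.sin θ, Real.cos θ, 0; 0, 0, 1]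

theorem rotMatrix_add (x y : ℝ) : rotMatrix (x + y) = rotMatrix x * rotMatrix y := by
  ext i j
  fin_cases i <;> fin_cases j <;>
    simp [rotMatrix, mul_apply, Fin.sum_univ_three, Real.cos_add, Real.sin_add] <;> ring

theorem rotMatrix_transpose (x : ℝ) : (rotMatrix x)ᵀ = rotMatrix (-x) := by
  ext i j
  fin_cases i <;> fin_cases j <;> simp [rotMatrix]

theorem rotMatrix_zero : rotMatrix 0 = 1 := by
  ext i j
  fin_cases i <;> fin_cases j <;> simp [rotMatrix]

theorem det_rotMatrix (x : ℝ) : (rotMatrix x).det = 1 := by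
  simp [rotMatrix, det_fin_three, ← sq]

theorem rotMatrix_mem (x : ℝ) : rotMatrix x ∈ unitaryGroup (Fin 3) ℝ := by
  rw [mem_unitaryGroup_iff, star_eq_conjTranspose, conjTranspose_eq_transpose_of_trivial,
    rotMatrix_transpose, ← rotMatrix_add, add_neg_cancel, rotMatrix_zero]

theorem continuous_rotMatrix : Continuous rotMatrix := by
  refine continuous_matrix fun i j => ?_
  fin_cases i <;> fin_cases j <;> simp [rotMatrix] <;> fun_prop

/-- Rotations in the plane of the first two coordinates. -/
noncomputable def rotZ (θ : ℝ) : SUgrp 3 ℝ :=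
  ⟨⟨rotMatrix θ, rotMatrix_mem θ⟩, det_rotMatrix θ⟩

/-- Rotations in the plane of the last two coordinates. -/
noncomputable def rotX (θ : ℝ) : SUgrp 3 ℝ :=
  ⟨⟨(rotMatrix θ).submatrix Fin.revPerm Fin.revPerm, by
    rw [mem_unitaryGroup_iff, star_eq_conjTranspose, conjTranspose_submatrix, submatrix_mul_equiv,
      ← star_eq_conjTranspose, mem_unitaryGroup_iff.1 (rotMatrix_mem θ), submatrix_one_equiv]⟩,
    (det_submatrix_equiv_self _ _).trans (det_rotMatrix θ)⟩

theorem SUgrp.ext_matrix {n : ℕ} {α : Type} [CommRing α] [StarRing α] {g h : SUgrp n α}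
    (e : (g : Matrix (Fin n) (Fin n) α) = h) : g = h :=
  Subtype.ext (Subtype.ext e)

theorem exists_rotation (p q : ℝ) : ∃ θ, Real.cos θ * p + Real.sin θ * q = 0 ∧
    -Real.sin θ * p + Real.cos θ * q = Real.sqrt (p ^ 2 + q ^ 2) := by
  have h1 := Complex.norm_mul_cos_arg (⟨q, -p⟩ : ℂ)
  have h2 := Complex.norm_mul_sin_arg (⟨q, -p⟩ : ℂ)
  have h3 : ‖(⟨q, -p⟩ : ℂ)‖ = Real.sqrt (p ^ 2 + q ^ 2) := by
    rw [Complex.norm_def, Complex.normSq_mk]; congr 1; ring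
  refine ⟨Complex.arg ⟨q, -p⟩, ?_, ?_⟩
  · simp only at h1 h2
    linear_combination Real.cos (Complex.arg ⟨q, -p⟩) * h2 - Real.sin (Complex.arg ⟨q, -p⟩) * h1
  · simp only [h3] at h1 h2
    have := Real.sin_sq_add_cos_sq (Complex.arg ⟨q, -p⟩)
    linear_combination -Real.sin (Complex.arg ⟨q, -p⟩) * h2 - Real.cos (Complex.arg ⟨q, -p⟩) * h1 +
      √(p ^ 2 + q ^ 2) * this

theorem closure_rotations :
    Subgroup.closure (Set.range rotZ ∪ Set.range rotX) = (⊤ : Subgroup (SUgrp 3 ℝ)) := by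
  rw [eq_top_iff]
  intro g _
  have hZ (x) : rotZ x ∈ Subgroup.closure (Set.range rotZ ∪ Set.range rotX) :=
    Subgroup.subset_closure (Or.inl ⟨x, rfl⟩)
  have hX (x) : rotX x ∈ Subgroup.closure (Set.range rotZ ∪ Set.range rotX) :=
    Subgroup.subset_closure (Or.inr ⟨x, rfl⟩)
  have orth (k : SUgrp 3 ℝ) (i : Fin 3) : k.1.1 i 0 ^ 2 + k.1.1 i 1 ^ 2 + k.1.1 i 2 ^ 2 = 1 := by
    have := congr_fun₂ (mem_unitaryGroup_iff.1 k.1.2) i i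
    simpa [mul_apply, Fin.sum_univ_three, ← sq] using this
  have orth' (k : SUgrp 3 ℝ) (i : Fin 3) : k.1.1 0 i ^ 2 + k.1.1 1 i ^ 2 + k.1.1 2 i ^ 2 = 1 := by
    have := congr_fun₂ (mem_unitaryGroup_iff'.1 k.1.2) i i
    simpa [mul_apply, Fin.sum_univ_three, ← sq] using this
  have eZ (x : ℝ) (k l : SUgrp 3 ℝ) (hl : l = rotZ x * k) (i : Fin 3) :
      l.1.1 0 i = Real.cos x * k.1.1 0 i + Real.sin x * k.1.1 1 i ∧
      l.1.1 1 i = -Real.sin x * k.1.1 0 i + Real.cos x * k.1.1 1 i ∧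
      l.1.1 2 i = k.1.1 2 i := by
    subst hl
    simp [rotZ, rotMatrix, mul_apply, Fin.sum_univ_three]
  have eX (x : ℝ) (k l : SUgrp 3 ℝ) (hl : l = rotX (-x) * k) (i : Fin 3) :
      l.1.1 0 i = k.1.1 0 i ∧
      l.1.1 1 i = Real.cos x * k.1.1 1 i + Real.sin x * k.1.1 2 i ∧
      l.1.1 2 i = -Real.sin x * k.1.1 1 i + Real.cos x * k.1.1 2 i := by
    subst hl
    simp [rotX, rotMatrix, mul_apply, Fin.sum_univ_three, Fin.rev]
  obtain ⟨x, hx, -⟩ := exists_rotation (g.1.1 0 2) (g.1.1 1 2)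
  obtain ⟨k, hk⟩ : ∃ k, k = rotZ x * g := ⟨_, rfl⟩
  have hk0 : k.1.1 0 2 = 0 := (eZ x g k hk 2).1.trans hx
  obtain ⟨y, hy1, hy2⟩ := exists_rotation (k.1.1 1 2) (k.1.1 2 2)
  obtain ⟨l, hl⟩ : ∃ l, l = rotX (-y) * k := ⟨_, rfl⟩
  have hl0 : l.1.1 0 2 = 0 := (eX y k l hl 2).1.trans hk0
  have hl1 : l.1.1 1 2 = 0 := (eX y k l hl 2).2.1.trans hy1
  have hl2 : l.1.1 2 2 = 1 := by
    rw [(eX y k l hl 2).2.2, hy2, Real.sqrt_eq_one, ← orth' k 2, hk0]; ring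
  have hl3 : l.1.1 2 1 = 0 := by
    have := orth l 2
    rw [hl2] at this
    nlinarith [sq_nonneg (l.1.1 2 0), sq_nonneg (l.1.1 2 1)]
  obtain ⟨z, hz1, hz2⟩ := exists_rotation (l.1.1 0 1) (l.1.1 1 1)
  obtain ⟨m, hm⟩ : ∃ m, m = rotZ z * l := ⟨_, rfl⟩
  have m02 : m.1.1 0 2 = 0 := by rw [(eZ z l m hm 2).1, hl0, hl1]; ring
  have m12 : m.1.1 1 2 = 0 := by rw [(eZ z l m hm 2).2.1, hl0, hl1]; ring
  have m22 : m.1.1 2 2 = 1 := by rw [(eZ z l m hm 2).2.2, hl2]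
  have m01 : m.1.1 0 1 = 0 := (eZ z l m hm 1).1.trans hz1
  have m11 : m.1.1 1 1 = 1 := by
    rw [(eZ z l m hm 1).2.1, hz2, Real.sqrt_eq_one, ← orth' l 1, hl3]; ring
  have m21 : m.1.1 2 1 = 0 := (eZ z l m hm 1).2.2.trans hl3
  have m10 : m.1.1 1 0 = 0 := by
    have := orth m 1
    rw [m11, m12] at this
    exact pow_eq_zero_iff two_ne_zero |>.1 (by linear_combination this)
  have m20 : m.1.1 2 0 = 0 := by
    have := orth m 2
    rw [m21, m22] at this
    exact pow_eq_zero_iff two_ne_zero |>.1 (by linear_combination this)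
  have m00 : m.1.1 0 0 = 1 := by
    have : m.1.1.det = 1 := m.2
    simpa [det_fin_three, m10, m20, m01, m21, m02, m12, m11, m22] using this
  have m1 : m = 1 := by
    apply SUgrp.ext_matrix
    ext i j
    fin_cases i <;> fin_cases j <;> simp [m00, m10, m20, m01, m21, m02, m12, m11, m22]
  rw [← (Subgroup.closure _).mul_mem_cancel_left (hZ x), ← hk,
    ← (Subgroup.closure _).mul_mem_cancel_left (hX (-y)), ← hl,
    ← (Subgroup.closure _).mul_mem_cancel_left (hZ z), ← hm, m1]
  exact one_mem _

theorem rotZ_add (x y : ℝ) : rotZ (x + y) = rotZ x * rotZ y :=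
  SUgrp.ext_matrix (rotMatrix_add x y)

theorem rotX_add (x y : ℝ) : rotX (x + y) = rotX x * rotX y := by
  apply SUgrp.ext_matrix
  change (rotMatrix (x + y)).submatrix _ _ =
    (rotMatrix x).submatrix Fin.revPerm Fin.revPerm * (rotMatrix y).submatrix _ _
  rw [rotMatrix_add, submatrix_mul_equiv]

theorem rotZ_zero : rotZ 0 = 1 :=
  SUgrp.ext_matrix rotMatrix_zero

theorem rotX_zero : rotX 0 = 1 := by
  apply SUgrp.ext_matrix
  change (rotMatrix 0).submatrix Fin.revPerm Fin.revPerm = 1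
  rw [rotMatrix_zero, submatrix_one_equiv]

theorem rotZ_inv (x : ℝ) : (rotZ x)⁻¹ = rotZ (-x) := by
  rw [inv_eq_iff_mul_eq_one, ← rotZ_add, add_neg_cancel, rotZ_zero]

theorem rotX_inv (x : ℝ) : (rotX x)⁻¹ = rotX (-x) := by
  rw [inv_eq_iff_mul_eq_one, ← rotX_add, add_neg_cancel, rotX_zero]

theorem rotX_pi_mul_rotZ (x : ℝ) : rotX Real.pi * rotZ x = rotZ (-x) * rotX Real.pi := by
  apply SUgrp.ext_matrix
  change (rotMatrix Real.pi).submatrix Fin.revPerm Fin.revPerm * rotMatrix x =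
    rotMatrix (-x) * (rotMatrix Real.pi).submatrix Fin.revPerm Fin.revPerm
  ext i j
  fin_cases i <;> fin_cases j <;> simp [rotMatrix, mul_apply, Fin.sum_univ_three, Fin.rev]

theorem rotZ_pi_mul_rotX (x : ℝ) : rotZ Real.pi * rotX x = rotX (-x) * rotZ Real.pi := by
  apply SUgrp.ext_matrix
  change rotMatrix Real.pi * (rotMatrix x).submatrix Fin.revPerm Fin.revPerm =
    (rotMatrix (-x)).submatrix Fin.revPerm Fin.revPerm * rotMatrix Real.pi
  ext i j
  fin_cases i <;> fin_cases j <;> simp [rotMatrix, mul_apply, Fin.sum_univ_three, Fin.rev]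

theorem continuous_rotZ : Continuous rotZ :=
  (continuous_rotMatrix.subtype_mk _).subtype_mk _

theorem continuous_rotX : Continuous rotX :=
  ((continuous_rotMatrix.matrix_submatrix _ _).subtype_mk _).subtype_mk _

theorem rotZ_pi_ne_one : rotZ Real.pi ≠ 1 := fun h => by
  have : (rotZ Real.pi).1.1 0 0 = 1 := by rw [h]; rfl
  simp [rotZ, rotMatrix] at this
  norm_num at this

theorem rotX_pi_ne_one : rotX Real.pi ≠ 1 := fun h => by
  have : (rotX Real.pi).1.1 1 1 = 1 := by rw [h]; rfl
  simp [rotX, rotMatrix, Fin.rev] at this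
  norm_num at this

theorem rotX_pi_ne_rotZ_pi : rotX Real.pi ≠ rotZ Real.pi := fun h => by
  have : (rotX Real.pi).1.1 0 0 = (rotZ Real.pi).1.1 0 0 := by rw [h]
  simp [rotX, rotZ, rotMatrix, Fin.rev] at this
  norm_num at this

/-- A plane rotation matrix with complex entries and real parameters. -/
def planeRot (a s : ℝ) : Matrix (Fin 3) (Fin 3) ℂ :=
  !![(a : ℂ), s, 0; -s, a, 0; 0, 0, 1]

theorem exists_unitary_conj_rotations (f : SUgrp 3 ℝ →* SUgrp 3 ℂ) (hf : Continuous f)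
    (hinj : Function.Injective f) :
    ∃ W : Matrix (Fin 3) (Fin 3) ℂ, W * Wᴴ = 1 ∧
      (∀ M, (∃ x, W * (f (rotZ x)).1.1 * Wᴴ = M) ↔
        ∃ a s : ℝ, a ^ 2 + s ^ 2 = 1 ∧ M = planeRot a s) ∧
      (∀ M, (∃ x, W * (f (rotX x)).1.1 * Wᴴ = M) ↔
        ∃ a s : ℝ, a ^ 2 + s ^ 2 = 1 ∧
          M = (planeRot a s).submatrix Fin.revPerm Fin.revPerm) := by
  have Fmul (g h) : (f (g * h)).1.1 = (f g).1.1 * (f h).1.1 := by rw [map_mul]; rfl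
  have Fone : (f 1).1.1 = 1 := by rw [map_one]; rfl
  have Fstar (g) : ((f g).1.1)ᴴ = (f g⁻¹).1.1 := by rw [map_inv]; rfl
  have Fdet (g) : (f g).1.1.det = 1 := (f g).2
  have Finj {g h} (e : (f g).1.1 = (f h).1.1) : g = h := hinj (SUgrp.ext_matrix e)
  have Fcont : Continuous fun g => (f g).1.1 :=
    continuous_subtype_val.comp (continuous_subtype_val.comp hf)
  have hZ2 : rotZ (-Real.pi) = rotZ Real.pi := by
    apply SUgrp.ext_matrix
    change rotMatrix _ = rotMatrix _
    simp [rotMatrix]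
  have hX2 : rotX (-Real.pi) = rotX Real.pi := by
    apply SUgrp.ext_matrix
    change (rotMatrix _).submatrix _ _ = (rotMatrix _).submatrix _ _
    simp [rotMatrix]
  obtain ⟨U, hU1, hU2, hUX, hUZ⟩ := exists_unitary_conj_klein (f (rotX Real.pi)).1.1
    (f (rotZ Real.pi)).1.1 (by rw [Fstar, rotX_inv, hX2]) (by rw [Fstar, rotZ_inv, hZ2])
    (by rw [← Fmul, ← Fone]; nth_rw 1 [← hX2]; rw [← rotX_add, neg_add_cancel, rotX_zero])
    (by rw [← Fmul, ← Fone]; nth_rw 1 [← hZ2]; rw [← rotZ_add, neg_add_cancel, rotZ_zero])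
    (by rw [← Fmul, ← Fmul, rotX_pi_mul_rotZ, hZ2]) (Fdet _) (Fdet _)
    (fun h => rotX_pi_ne_one (Finj (h.trans Fone.symm)))
    (fun h => rotZ_pi_ne_one (Finj (h.trans Fone.symm)))
    (fun h => rotX_pi_ne_rotZ_pi (Finj h))
  obtain ⟨G, hG⟩ : ∃ G : SUgrp 3 ℝ → Matrix (Fin 3) (Fin 3) ℂ,
    ∀ g, G g = Uᴴ * (f g).1.1 * U := ⟨_, fun _ => rfl⟩
  have Gmul (g h) : G (g * h) = G g * G h := by
    rw [hG, hG, hG, Fmul]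
    calc _ = Uᴴ * (f g).1.1 * 1 * (f h).1.1 * U := by simp only [mul_assoc, one_mul]
      _ = _ := by rw [← hU2]; simp only [mul_assoc]
  have Gone : G 1 = 1 := by rw [hG, Fone, mul_one, hU1]
  have Gstar (g) : (G g)ᴴ = G g⁻¹ := by
    rw [hG, hG, conjTranspose_mul, conjTranspose_mul, conjTranspose_conjTranspose, Fstar, mul_assoc]
  have Gdet (g) : (G g).det = 1 := by
    have : U.det * Uᴴ.det = 1 := by rw [← det_mul, hU2, det_one]
    rw [hG, det_mul, det_mul, Fdet]; linear_combination this
  have Gcont : Continuous G := by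
    rw [funext hG]
    exact (continuous_const.matrix_mul Fcont).matrix_mul continuous_const
  rw [← hG] at hUX hUZ
  have hrev1 : (diagonal ![1, -1, -1] : Matrix (Fin 3) (Fin 3) ℂ).submatrix Fin.revPerm Fin.revPerm
      = diagonal ![-1, -1, 1] := by
    rw [submatrix_diagonal_equiv]; congr 1; ext i; fin_cases i <;> rfl
  have hrev2 : (diagonal ![-1, -1, 1] : Matrix (Fin 3) (Fin 3) ℂ).submatrix Fin.revPerm Fin.revPerm
      = diagonal ![1, -1, -1] := by
    rw [submatrix_diagonal_equiv]; congr 1; ext i; fin_cases i <;> rfl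
  obtain ⟨w, hw, hwZ⟩ := exists_range_eq_rotations (fun x => G (rotZ x))
    (Gcont.comp continuous_rotZ) (by rw [rotZ_zero, Gone]) hUZ
    (fun x y => by rw [rotZ_add, Gmul]) (fun x => by rw [Gstar, rotZ_inv]) (fun x => Gdet _)
    (fun x => by rw [← hUX, ← Gmul, rotX_pi_mul_rotZ, Gmul])
  obtain ⟨v, hv, hvX⟩ := exists_range_eq_rotations
    (fun x => (G (rotX x)).submatrix Fin.revPerm Fin.revPerm)
    ((Gcont.comp continuous_rotX).matrix_submatrix _ _)
    (by rw [rotX_zero, Gone, submatrix_one_equiv]) (by rw [hUX, hrev1])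
    (fun x y => by rw [rotX_add, Gmul, submatrix_mul_equiv])
    (fun x => by rw [conjTranspose_submatrix, Gstar, rotX_inv])
    (fun x => by rw [det_submatrix_equiv_self, Gdet])
    (fun x => by rw [← hrev2, submatrix_mul_equiv, submatrix_mul_equiv, ← hUZ, ← Gmul,
      rotZ_pi_mul_rotX, Gmul])
  obtain ⟨D, hD⟩ : ∃ D : Matrix (Fin 3) (Fin 3) ℂ, D = diagonal ![star w, 1, star v] := ⟨_, rfl⟩
  have hw' : star w * w = 1 := by rw [mul_comm, hw]
  have hv' : star v * v = 1 := by rw [mul_comm, hv]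
  have hDD : D * Dᴴ = 1 := by
    rw [hD, diagonal_conjTranspose, diagonal_mul_diagonal, ← diagonal_one]
    congr 1; ext i
    simp only [RCLike.star_def] at hw' hv'
    fin_cases i <;> simp [hw', hv']
  have hDD' : Dᴴ * D = 1 := mul_eq_one_comm.1 hDD
  have key (g) (M) : D * Uᴴ * (f g).1.1 * (D * Uᴴ)ᴴ = M ↔ G g = Dᴴ * M * D := by
    have e : D * Uᴴ * (f g).1.1 * (D * Uᴴ)ᴴ = D * G g * Dᴴ := by
      rw [hG, conjTranspose_mul, conjTranspose_conjTranspose]; simp only [mul_assoc]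
    rw [e]
    constructor
    · rintro rfl
      calc _ = (Dᴴ * D) * G g * (Dᴴ * D) := by rw [hDD', one_mul, mul_one]
        _ = _ := by simp only [mul_assoc]
    · intro h
      rw [h]
      calc _ = (D * Dᴴ) * M * (D * Dᴴ) := by simp only [mul_assoc]
        _ = _ := by rw [hDD, one_mul, mul_one]
  have inj (M N : Matrix (Fin 3) (Fin 3) ℂ) : Dᴴ * M * D = N ↔ M = D * N * Dᴴ := by
    constructor
    · rintro rfl
      calc _ = (D * Dᴴ) * M * (D * Dᴴ) := by rw [hDD, one_mul, mul_one]
        _ = _ := by simp only [mul_assoc]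
    · rintro rfl
      calc _ = (Dᴴ * D) * N * (Dᴴ * D) := by simp only [mul_assoc]
        _ = _ := by rw [hDD', one_mul, mul_one]
  refine ⟨D * Uᴴ, ?_, fun M => ?_, fun M => ?_⟩
  · rw [conjTranspose_mul, conjTranspose_conjTranspose]
    calc _ = D * (Uᴴ * U) * Dᴴ := by simp only [mul_assoc]
      _ = 1 := by rw [hU1, mul_one, hDD]
  · simp only [key, hwZ, inj]
    have e (a s : ℝ) : D * !![(a : ℂ), s * w, 0; -(s * star w), a, 0; 0, 0, 1] * Dᴴ =
        planeRot a s := by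
      rw [hD, diagonal_conjTranspose]
      simp only [RCLike.star_def] at hw' hv'
      ext i j
      rw [mul_diagonal, diagonal_mul]
      fin_cases i <;> fin_cases j <;> simp [planeRot, hv']
      · linear_combination (a : ℂ) * hw'
      · linear_combination (s : ℂ) * hw'
      · linear_combination (s : ℂ) * hw'
    simp only [e]
  · have hrr (N N' : Matrix (Fin 3) (Fin 3) ℂ) :
        N = N' ↔ N.submatrix Fin.revPerm Fin.revPerm = N'.submatrix Fin.revPerm Fin.revPerm := by
      constructor
      · rintro rfl; rfl
      · intro h
        ext i j
        simpa using congr_fun₂ h (Fin.rev i) (Fin.rev j)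
    have e (a s : ℝ) : D * !![(a : ℂ), s * v, 0; -(s * star v), a, 0; 0, 0, 1].submatrix
        Fin.revPerm Fin.revPerm * Dᴴ = (planeRot a s).submatrix Fin.revPerm Fin.revPerm := by
      rw [hD, diagonal_conjTranspose]
      simp only [RCLike.star_def] at hw' hv'
      ext i j
      rw [mul_diagonal, diagonal_mul]
      fin_cases i <;> fin_cases j <;> simp [planeRot, Fin.rev, hw']
      · linear_combination (s : ℂ) * hv'
      · linear_combination (s : ℂ) * hv'
      · linear_combination (a : ℂ) * hv'
    have e2 (N N' : Matrix (Fin 3) (Fin 3) ℂ) : N.submatrix Fin.revPerm Fin.revPerm = N' ↔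
        N = N'.submatrix Fin.revPerm Fin.revPerm := by
      rw [hrr N]; simp [submatrix_submatrix, Function.comp_def, ← Matrix.ext_iff]
    simp only [key]
    simp_rw [hrr (G _), hvX, e2, inj, e]

theorem exists_conj_range_eq (f : SUgrp 3 ℝ →* SUgrp 3 ℂ) (hf : Continuous f)
    (hinj : Function.Injective f) :
    ∃ u : SUgrp 3 ℂ, f.range.map (MulAut.conj u).toMonoidHom = Subgroup.closure
      ({g | ∃ a s : ℝ, a ^ 2 + s ^ 2 = 1 ∧ g.1.1 = planeRot a s} ∪
        {g | ∃ a s : ℝ, a ^ 2 + s ^ 2 = 1 ∧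
          g.1.1 = (planeRot a s).submatrix Fin.revPerm Fin.revPerm}) := by
  obtain ⟨W, hW, hWZ, hWX⟩ := exists_unitary_conj_rotations f hf hinj
  have hWdet : W.det * star W.det = 1 := by
    rw [← det_conjTranspose, ← det_mul, hW, det_one]
  have hW0 : W.det ≠ 0 := left_ne_zero_of_mul_eq_one hWdet
  obtain ⟨c, hc⟩ := IsAlgClosed.exists_pow_nat_eq (W.det⁻¹) (show 0 < 3 by norm_num)
  have hcn : c * star c = 1 := by
    have h1 : ‖W.det‖ = 1 := by
      have := congr_arg norm hWdet
      rw [norm_mul, norm_star, norm_one, ← sq] at this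
      exact (pow_eq_one_iff_of_nonneg (norm_nonneg _) two_ne_zero).1 this
    have h2 : ‖c‖ = 1 := by
      have := congr_arg norm hc
      rw [norm_pow, norm_inv, h1, inv_one] at this
      exact (pow_eq_one_iff_of_nonneg (norm_nonneg _) three_ne_zero).1 this
    rw [RCLike.star_def, Complex.mul_conj, Complex.normSq_eq_norm_sq, h2]; simp
  have hu : (c • W) * (c • W)ᴴ = 1 := by
    rw [conjTranspose_smul, smul_mul_smul_comm, hcn, hW, one_smul]
  let u : SUgrp 3 ℂ := ⟨⟨c • W, mem_unitaryGroup_iff.2 hu⟩, by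
    change (c • W).det = 1
    rw [det_smul, Fintype.card_fin, hc, inv_mul_cancel₀ hW0]⟩
  have conj_eq (g h : SUgrp 3 ℂ) : MulAut.conj u g = h ↔ W * g.1.1 * Wᴴ = h.1.1 := by
    have e : (MulAut.conj u g).1.1 = W * g.1.1 * Wᴴ := by
      change (c • W) * g.1.1 * (c • W)ᴴ = _
      rw [conjTranspose_smul, smul_mul_assoc, smul_mul_smul_comm, hcn, one_smul]
    rw [← e]
    exact ⟨fun h => by rw [h], fun h => SUgrp.ext_matrix h⟩
  refine ⟨u, ?_⟩
  rw [MonoidHom.range_eq_map, Subgroup.map_map, ← closure_rotations, MonoidHom.map_closure,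
    Set.image_union, ← Set.range_comp, ← Set.range_comp]
  congr 2
  · ext g
    exact (exists_congr fun x => conj_eq _ _).trans (hWZ _)
  · ext g
    exact (exists_congr fun x => conj_eq _ _).trans (hWX _)

/-- All copies of `SO(3)` inside `SU(3)` are conjugate: if `H₁` and
`H₂` are subgroups of `SU(3)` each of which, with the subspace topology, is isomorphic
as a topological group to `SO(3)` (`= SUgrp 3 ℝ`), then there is `u ∈ SU(3)` with
`u·H₁·u⁻¹ = H₂`. -/
theorem stmt17
    (H₁ H₂ : Subgroup (SUgrp 3 ℂ))
    (h₁ : ∃ e : H₁ ≃* SUgrp 3 ℝ, Continuous e ∧ Continuous e.symm)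
    (h₂ : ∃ e : H₂ ≃* SUgrp 3 ℝ, Continuous e ∧ Continuous e.symm) :
    ∃ u : SUgrp 3 ℂ, Subgroup.map (MulAut.conj u).toMonoidHom H₁ = H₂ := by
  have main (H : Subgroup (SUgrp 3 ℂ)) (h : ∃ e : H ≃* SUgrp 3 ℝ, Continuous e ∧ Continuous e.symm) :
      ∃ u : SUgrp 3 ℂ, H.map (MulAut.conj u).toMonoidHom = Subgroup.closure
      ({g | ∃ a s : ℝ, a ^ 2 + s ^ 2 = 1 ∧ g.1.1 = planeRot a s} ∪
        {g | ∃ a s : ℝ, a ^ 2 + s ^ 2 = 1 ∧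
          g.1.1 = (planeRot a s).submatrix Fin.revPerm Fin.revPerm}) := by
    obtain ⟨e, -, he⟩ := h
    have hr : (H.subtype.comp e.symm.toMonoidHom).range = H := by
      rw [MonoidHom.range_comp, MonoidHom.range_eq_top.2 e.symm.surjective,
        ← MonoidHom.range_eq_map, Subgroup.range_subtype]
    have := exists_conj_range_eq (H.subtype.comp e.symm.toMonoidHom)
      (continuous_subtype_val.comp he) (Subtype.val_injective.comp e.symm.injective)
    rwa [hr] at this
  obtain ⟨u₁, hu₁⟩ := main H₁ h₁
  obtain ⟨u₂, hu₂⟩ := main H₂ h₂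
  refine ⟨u₂⁻¹ * u₁, ?_⟩
  have h : ((MulAut.conj (u₂⁻¹ * u₁)).toMonoidHom : SUgrp 3 ℂ →* SUgrp 3 ℂ) =
      (MulAut.conj u₂⁻¹).toMonoidHom.comp (MulAut.conj u₁).toMonoidHom := by
    ext1 g; simp
  rw [h, ← Subgroup.map_map, hu₁, ← hu₂, Subgroup.map_map]
  convert Subgroup.map_id H₂
  ext1 g; simp [mul_assoc]
end
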